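/- For all integers ℓ, ℓ' ≥ 1, there is a poset isomorphism sτtilt Λ^{(ℓ,ℓ')} ≅ P_{ℓ,ℓ'}. -/

import Mathlib

/-!
Common framework for formalizing statements from
"From support τ-tilting posets to algebras" (R. Kase).

Modules over the basic finite dimensional algebra `Λ` are taken to be *right*
modules, encoded as (left) modules over the opposite ring `Λᵐᵒᵖ`.
τ-rigidity is encoded through the Auslander–Smalø criterion:
`Hom(M, τM) = 0` iff `Ext¹(M, Fac M) = 0`, and the vanishing of `Ext¹(M, X)`
is encoded by the splitting of all short exact sequences `0 → X → E → M → 0`.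
-/

open MulOpposite

namespace TauTilting

/-- Bundled modules over `A` (in `Type 0`). -/
abbrev Mdl (A : Type) [Ring A] := ModuleCat.{0} A

variable {A B : Type} [Ring A] [Ring B]

/-- `X ∈ Fac M` : `X` is a factor of a finite direct sum of copies of `M`. -/
def MemFac (M X : Mdl A) : Prop :=
  ∃ (n : ℕ) (f : (Fin n → M) →ₗ[A] X), Function.Surjective f

/-- Every short exact sequence `0 → X → E → M → 0` splits, i.e. `Ext¹(M, X) = 0`. -/
def Ext1Vanish (M X : Mdl A) : Prop :=
  ∀ (E : Mdl A) (f : X →ₗ[A] E) (g : E →ₗ[A] M),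
    Function.Injective f → Function.Surjective g →
    LinearMap.range f = LinearMap.ker g →
    ∃ s : M →ₗ[A] E, g.comp s = LinearMap.id

/-- `M` is τ-rigid (Auslander–Smalø: `Hom(M, τM) = 0 ↔ Ext¹(M, Fac M) = 0`). -/
def IsTauRigid (M : Mdl A) : Prop :=
  Module.Finite A M ∧ ∀ X : Mdl A, MemFac M X → Ext1Vanish M X

/-- `M` is indecomposable. -/
def IsIndec (M : Mdl A) : Prop :=
  Nontrivial M ∧ ∀ N N' : Submodule A M, IsCompl N N' → N = ⊥ ∨ N' = ⊥

/-- `F` is an (internal) decomposition of `M` into indecomposable direct summands. -/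
def IsDecompOf (M : Mdl A) {n : ℕ} (F : Fin n → Submodule A M) : Prop :=
  iSupIndep F ∧ iSup F = ⊤ ∧ ∀ k, IsIndec (ModuleCat.of A (F k))

/-- `|M| = n` : `M` decomposes into `n` indecomposable direct summands. -/
def HasNumSummands (M : Mdl A) (n : ℕ) : Prop :=
  ∃ F : Fin n → Submodule A M, IsDecompOf M F

/-- `M` is basic: its indecomposable direct summands are pairwise non-isomorphic. -/
def IsBasicMod (M : Mdl A) : Prop :=
  ∃ (n : ℕ) (F : Fin n → Submodule A M), IsDecompOf M F ∧
    ∀ k l : Fin n, k ≠ l → IsEmpty (↥(F k) ≃ₗ[A] ↥(F l))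

def ModIso (M N : Mdl A) : Prop := Nonempty (M ≃ₗ[A] N)

/-- The order on support τ-tilting modules: `M ≤ N ↔ Fac M ⊆ Fac N`. -/
def FacLE (M N : Mdl A) : Prop := ∀ X : Mdl A, MemFac M X → MemFac N X
def FacLT (M N : Mdl A) : Prop := FacLE M N ∧ ¬ FacLE N M
/-- Equality in the poset of iso-classes: mutual `≤`. -/
def PE (M N : Mdl A) : Prop := FacLE M N ∧ FacLE N M

/-- `N` is a direct summand of `M`. -/
def IsSummand (N M : Mdl A) : Prop :=
  ∃ (f : N →ₗ[A] M) (g : M →ₗ[A] N), g.comp f = LinearMap.id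
/-- `N ∈ add M`. -/
def InAdd (N M : Mdl A) : Prop := ∃ n : ℕ, IsSummand N (ModuleCat.of A (Fin n → M))
def HomZero (R M : Mdl A) : Prop := ∀ f : R →ₗ[A] M, f = 0

/-- Direct sum of two bundled modules. -/
def dsum (M N : Mdl A) : Mdl A := ModuleCat.of A (M × N)

/-- Hasse-quiver arrow `M → N` (so `N` is a direct successor of `M`, and `M` a
direct predecessor of `N`) in the poset of all modules satisfying `P`,
ordered by `FacLE`. -/
def HArrow (P : Mdl A → Prop) (M N : Mdl A) : Prop :=
  P M ∧ P N ∧ FacLT N M ∧ ∀ C, P C → FacLT N C → FacLT C M → False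

def IsMaxOf (P : Mdl A → Prop) (T : Mdl A) : Prop := P T ∧ ∀ S, P S → FacLE S T
def IsMinOf (P : Mdl A → Prop) (T : Mdl A) : Prop := P T ∧ ∀ S, P S → FacLE T S

/-- `T` has exactly `n` direct successors (counted up to poset equality). -/
def SuccsCard (P : Mdl A → Prop) (T : Mdl A) (n : ℕ) : Prop :=
  ∃ g : Fin n → Mdl A, (∀ k, HArrow P T (g k)) ∧
    (∀ k l, k ≠ l → ¬ PE (g k) (g l)) ∧ ∀ S, HArrow P T S → ∃ k, PE S (g k)

/-- `T` has exactly `n` direct predecessors (counted up to poset equality). -/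
def PredsCard (P : Mdl A → Prop) (T : Mdl A) (n : ℕ) : Prop :=
  ∃ g : Fin n → Mdl A, (∀ k, HArrow P (g k) T) ∧
    (∀ k l, k ≠ l → ¬ PE (g k) (g l)) ∧ ∀ S, HArrow P S T → ∃ k, PE S (g k)

/-- The poset of modules satisfying `P` (ordered by `FacLE`) is a lattice. -/
def IsLatticeP (P : Mdl A → Prop) : Prop :=
  ∀ M N, P M → P N →
    (∃ J, P J ∧ FacLE M J ∧ FacLE N J ∧ ∀ C, P C → FacLE M C → FacLE N C → FacLE J C) ∧
    (∃ W, P W ∧ FacLE W M ∧ FacLE W N ∧ ∀ C, P C → FacLE C M → FacLE C N → FacLE C W)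

/-- A poset isomorphism between the posets (of isomorphism classes) of modules
satisfying `PA` resp. `PB`, ordered by `FacLE`. -/
structure PosetIsoP (PA : Mdl A → Prop) (PB : Mdl B → Prop) where
  toFun : Mdl A → Mdl B
  invFun : Mdl B → Mdl A
  maps : ∀ M, PA M → PB (toFun M)
  maps' : ∀ N, PB N → PA (invFun N)
  le_iff : ∀ M N, PA M → PA N → (FacLE M N ↔ FacLE (toFun M) (toFun N))
  le_iff' : ∀ M N, PB M → PB N → (FacLE M N ↔ FacLE (invFun M) (invFun N))
  left_inv : ∀ M, PA M → PE (invFun (toFun M)) M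
  right_inv : ∀ N, PB N → PE (toFun (invFun N)) N

/-- A poset isomorphism between the poset of modules satisfying `P` and an
abstract poset `(β, le)`. -/
structure PosetIsoTo (P : Mdl A → Prop) (β : Type) (le : β → β → Prop) where
  toFun : Mdl A → β
  invFun : β → Mdl A
  maps' : ∀ b, P (invFun b)
  le_iff : ∀ M N, P M → P N → (FacLE M N ↔ le (toFun M) (toFun N))
  left_inv : ∀ M, P M → PE (invFun (toFun M)) M
  right_inv : ∀ b, toFun (invFun b) = b

/-! ### Ring-level notions -/

variable (Λ : Type) [Ring Λ]

/-- The right ideal generated by a subset, as a right module (i.e. `Λᵐᵒᵖ`-module). -/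
def rSpan (S : Set Λ) : Submodule Λᵐᵒᵖ Λ := Submodule.span Λᵐᵒᵖ S
/-- The two-sided ideal `(q) = ΛqΛ`, as a right `Λ`-module. -/
def tIdeal (q : Λ) : Submodule Λᵐᵒᵖ Λ := Submodule.span Λᵐᵒᵖ {y : Λ | ∃ a : Λ, y = a * q}
/-- The right `Λ`-module `Λ/S`. -/
def quotMod (S : Submodule Λᵐᵒᵖ Λ) : Mdl Λᵐᵒᵖ := ModuleCat.of Λᵐᵒᵖ (Λ ⧸ S)
/-- `Λ` as a right module over itself. -/
def regMod : Mdl Λᵐᵒᵖ := ModuleCat.of Λᵐᵒᵖ Λ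
/-- The projective right module `xΛ ≅ Λ/(1-x)Λ` attached to an idempotent `x`. -/
def projMod (x : Λ) : Mdl Λᵐᵒᵖ := quotMod Λ (rSpan Λ {1 - x})
/-- The right `Λ`-module `Λ/(1-x)`; for `x = e i` this is the module `X_i`. -/
def cyclicQuot (x : Λ) : Mdl Λᵐᵒᵖ := quotMod Λ (tIdeal Λ (1 - x))

/-- `x` is a primitive idempotent. -/
def IsPrimIdem (x : Λ) : Prop :=
  IsIdempotentElem x ∧ x ≠ 0 ∧
    ∀ a b : Λ, IsIdempotentElem a → IsIdempotentElem b →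
      a * b = 0 → b * a = 0 → a + b = x → a = 0 ∨ b = 0

variable {ι : Type} [Fintype ι]

/-- `e` is a complete family of orthogonal primitive idempotents of `Λ`. -/
def CompletePrimIdems (e : ι → Λ) : Prop :=
  (∀ i, IsPrimIdem Λ (e i)) ∧ (Pairwise fun i j => e i * e j = 0) ∧ ∑ i, e i = 1

/-- `Λ` is basic w.r.t. `e`: the `e i Λ` are pairwise non-isomorphic. -/
def IsBasicAlg (e : ι → Λ) : Prop :=
  ∀ i j : ι, i ≠ j → IsEmpty (↥(projMod Λ (e i)) ≃ₗ[Λᵐᵒᵖ] ↥(projMod Λ (e j)))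

/-- The support `supp(M) = {i | M·eᵢ ≠ 0}` of a right module `M`. -/
def Supp (e : ι → Λ) (M : Mdl Λᵐᵒᵖ) : Set ι := {i | ∃ m : M, op (e i) • m ≠ 0}

/-- Support τ-tilting module: τ-rigid with `|M| = #supp(M)`. -/
def IsSTT (e : ι → Λ) (M : Mdl Λᵐᵒᵖ) : Prop :=
  Module.Finite Λᵐᵒᵖ M ∧ IsTauRigid M ∧ HasNumSummands M (Supp Λ e M).ncard

/-- Basic support τ-tilting module. -/
def IsBSTT (e : ι → Λ) (M : Mdl Λᵐᵒᵖ) : Prop := IsSTT Λ e M ∧ IsBasicMod M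

/-- τ-tilting module: τ-rigid with `|M| = #Q₀`. -/
def IsTauTiltingMod (e : ι → Λ) (M : Mdl Λᵐᵒᵖ) : Prop :=
  IsSTT Λ e M ∧ HasNumSummands M (Fintype.card ι)

open scoped Classical in
/-- The idempotent `1 - e_M = Σ_{i ∉ supp M} e i`. -/
noncomputable def cIdem (e : ι → Λ) (M : Mdl Λᵐᵒᵖ) : Λ :=
  ∑ i : ι, if i ∈ Supp Λ e M then 0 else e i

/-- τ-rigid pair `(M, P)`. -/
def IsTauRigidPair (e : ι → Λ) (M P : Mdl Λᵐᵒᵖ) : Prop :=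
  IsTauRigid M ∧ Module.Finite Λᵐᵒᵖ P ∧ Module.Projective Λᵐᵒᵖ P ∧
    InAdd P (projMod Λ (cIdem Λ e M))

/-- Basic τ-rigid pair. -/
def IsBasicTRP (e : ι → Λ) (M P : Mdl Λᵐᵒᵖ) : Prop :=
  IsTauRigidPair Λ e M P ∧ IsBasicMod M ∧ IsBasicMod P

/-- `T ∈ sτtilt_{(N,R)} Λ`, i.e. `N ∈ add T` and `Hom(R, T) = 0`. -/
def InPairSet (N R T : Mdl Λᵐᵒᵖ) : Prop := InAdd N T ∧ HomZero R T

/-- `Λ` is τ-tilting finite: finitely many basic support τ-tilting modules up to iso. -/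
def TauTiltingFinite (e : ι → Λ) : Prop :=
  ∃ (n : ℕ) (T : Fin n → Mdl Λᵐᵒᵖ), ∀ M, IsBSTT Λ e M → ∃ k, ModIso M (T k)

/-- The Jacobson radical of `Λ`, as a `K`-subspace. -/
noncomputable def radK (K : Type) [CommRing K] (Λ : Type) [Ring Λ] [Algebra K Λ] :
    Submodule K Λ :=
  Submodule.restrictScalars K (sInf {I : Ideal Λ | I.IsMaximal})

/-- Powers of the radical, with `rad⁰ = Λ`. -/
noncomputable def radPow (K : Type) [CommRing K] (Λ : Type) [Ring Λ] [Algebra K Λ] :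
    ℕ → Submodule K Λ
  | 0 => ⊤
  | n + 1 => radK K Λ ^ (n + 1)

/-! ### Quivers, paths and presentations -/

/-- Paths in a quiver with vertex set `ι` and arrow types `Arr i j`. -/
inductive QPath {ι : Type} (Arr : ι → ι → Type) : ι → ι → Type
  | nil (i : ι) : QPath Arr i i
  | cons {i j k : ι} (a : Arr i j) (p : QPath Arr j k) : QPath Arr i k

namespace QPath

variable {ι : Type} {Arr : ι → ι → Type}

/-- The list of visited vertices. -/
def verts : ∀ {i j : ι}, QPath Arr i j → List ι
  | i, _, .nil _ => [i]
  | i, _, .cons _ p => i :: p.verts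

/-- Evaluation of a path in the algebra `Λ` (trivial path at `i` ↦ `e i`). -/
def eval {Λ : Type} [Ring Λ] (e : ι → Λ) (arr : ∀ i j, Arr i j → Λ) :
    ∀ {i j : ι}, QPath Arr i j → Λ
  | _, _, .nil i => e i
  | _, _, .cons a p => arr _ _ a * p.eval e arr

def append : ∀ {i j k : ι}, QPath Arr i j → QPath Arr j k → QPath Arr i k
  | _, _, _, .nil _, q => q
  | _, _, _, .cons a p, q => .cons a (p.append q)

def single {i j : ι} (a : Arr i j) : QPath Arr i j := .cons a (.nil j)

end QPath

/-- The condition `xΛe_j = e_iΛe_j = e_iΛx ≠ 0` on an element `x` of `e_iΛe_j`. -/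
def Gcond (ei ej x : Λ) : Prop :=
  (Set.range fun b => x * b * ej) = (Set.range fun b => ei * b * ej) ∧
  (Set.range fun b => ei * b * x) = (Set.range fun b => ei * b * ej) ∧
  ∃ b, ei * b * ej ≠ 0

/-- `w ∈ G(Q, I)` : `w` contains no cycle as a subpath (equivalently, visits no
vertex twice) and `wΛe_j = e_iΛe_j = e_iΛw ≠ 0`. -/
def GMem (e : ι → Λ) {Arr : ι → ι → Type} (arr : ∀ i j, Arr i j → Λ) {i j : ι}
    (w : QPath Arr i j) : Prop :=
  w.verts.Nodup ∧ Gcond Λ (e i) (e j) (w.eval e arr)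

/-- Condition 1 for a bound quiver: if `e_iΛe_j ≠ 0` then `G^i_j ≠ ∅`. -/
def Cond1 (e : ι → Λ) {Arr : ι → ι → Type} (arr : ∀ i j, Arr i j → Λ) : Prop :=
  ∀ i j : ι, (∃ x, e i * x * e j ≠ 0) → ∃ w : QPath Arr i j, GMem Λ e arr w

/-- Ring-level version of Condition 1 (Lemma `eqcd` (iii)). -/
def Cond1R : Prop :=
  ∀ x y : Λ, IsPrimIdem Λ x → IsPrimIdem Λ y → x * y = 0 → y * x = 0 →
    ∃ w : Λ, (∃ b, w = x * b * y) ∧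
      (Set.range fun b => w * b * y) = (Set.range fun b => x * b * y) ∧
      (Set.range fun b => x * b * w) = (Set.range fun b => x * b * y)

/-- `(e, Arr, arr)` presents `Λ` as the bound quiver algebra `KQ/I` with `Q` its
Gabriel quiver: `e` is a complete family of orthogonal primitive idempotents,
`Λ` is basic, each arrow `a : i → j` is sent to an element of `e_i (rad Λ) e_j`,
and the arrows form a `K`-basis of `rad Λ / rad² Λ`. -/
def IsGabrielPres (K : Type) [Field K] [Algebra K Λ] [DecidableEq ι] (e : ι → Λ)
    (Arr : ι → ι → Type) [∀ i j, Fintype (Arr i j)] (arr : ∀ i j, Arr i j → Λ) : Prop :=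
  CompletePrimIdems Λ e ∧ IsBasicAlg Λ e ∧
  (∀ i j (a : Arr i j), arr i j a ∈ radK K Λ ∧ e i * arr i j a * e j = arr i j a) ∧
  (radK K Λ ≤
    Submodule.span K (Set.range fun p : Σ i : ι, Σ j : ι, Arr i j => arr p.1 p.2.1 p.2.2) ⊔
      radK K Λ * radK K Λ) ∧
  (∀ c : (Σ i : ι, Σ j : ι, Arr i j) → K,
    (∑ p : Σ i : ι, Σ j : ι, Arr i j, c p • arr p.1 p.2.1 p.2.2) ∈ radK K Λ * radK K Λ →
    ∀ p, c p = 0)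

/-! ### Partitions of a quiver, Condition 2 -/

/-- `x` and `y` are adjacent within the vertex subset `S` (undirected). -/
def AdjIn {ι : Type} (Arr : ι → ι → Type) (S : Set ι) (x y : ι) : Prop :=
  x ∈ S ∧ y ∈ S ∧ (Nonempty (Arr x y) ∨ Nonempty (Arr y x))

/-- The full subquiver on `S` is connected. -/
def ConnectedOn {ι : Type} (Arr : ι → ι → Type) (S : Set ι) : Prop :=
  ∀ x ∈ S, ∀ y ∈ S, Relation.ReflTransGen (AdjIn Arr S) x y

/-- Adjacency of parts in the quotient quiver `Q^μ`. -/
def PartAdj {ι : Type} (Arr : ι → ι → Type) {ℓ : ℕ} (μ : ι → Fin ℓ) (u v : Fin ℓ) : Prop :=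
  u ≠ v ∧ ∃ x y, μ x = u ∧ μ y = v ∧ (Nonempty (Arr x y) ∨ Nonempty (Arr y x))

/-- Condition 2: there is a partition `μ` of `Q₀` into connected full subquivers
such that `Q^μ` is a tree (connected with `#arrows = #parts - 1`) and each
`sτtilt Λ^{a,b}_μ` — identified with the subposet of `sτtilt Λ` of modules
supported on the union of the two parts — is a lattice. -/
def Cond2 (e : ι → Λ) (Arr : ι → ι → Type) [∀ i j, Fintype (Arr i j)] : Prop :=
  ∃ (ℓ : ℕ) (μ : ι → Fin ℓ), Function.Surjective μ ∧
    (∀ a : Fin ℓ, ConnectedOn Arr {i | μ i = a}) ∧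
    (∀ u v : Fin ℓ, Relation.ReflTransGen (PartAdj Arr μ) u v) ∧
    Nat.card {p : Σ i : ι, Σ j : ι, Arr i j // μ p.1 ≠ μ p.2.1} = ℓ - 1 ∧
    ∀ a b : Fin ℓ, a ≠ b →
      IsLatticeP (fun T : Mdl Λᵐᵒᵖ => IsBSTT Λ e T ∧ Supp Λ e T ⊆ {i | μ i = a ∨ μ i = b})

/-! ### Correspondence of paths under a quiver isomorphism, and `∼` -/

/-- Transport of paths along a quiver isomorphism `σ : Q° → (Q')°` (defined on
non-loop arrows). -/
inductive PathCorr {ι ι' : Type} {Arr : ι → ι → Type} {Arr' : ι' → ι' → Type}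
    (σ : ι → ι') (σ1 : ∀ i j, i ≠ j → Arr i j → Arr' (σ i) (σ j)) :
    ∀ {i j : ι}, QPath Arr i j → QPath Arr' (σ i) (σ j) → Prop
  | nil (i : ι) : PathCorr σ σ1 (QPath.nil i) (QPath.nil (σ i))
  | cons {i j k : ι} (h : i ≠ j) (a : Arr i j) {p : QPath Arr j k}
      {p' : QPath Arr' (σ j) (σ k)} :
      PathCorr σ σ1 p p' → PathCorr σ σ1 (QPath.cons a p) (QPath.cons (σ1 i j h a) p')

/-- The relation `(Q, I) ∼ (Q', I')`: there is a quiver isomorphism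
`σ : Q° → (Q')°` with (a) `supp(e_{σ(i)}Γ) = σ(supp(e_iΛ))` and (b) `G(Γ) = σ(G(Λ))`. -/
def SimCond {Λ Γ : Type} [Ring Λ] [Ring Γ] {ι ι' : Type}
    (e : ι → Λ) {Arr : ι → ι → Type} (arr : ∀ i j, Arr i j → Λ)
    (f : ι' → Γ) {Arr' : ι' → ι' → Type} (arr' : ∀ i j, Arr' i j → Γ) : Prop :=
  ∃ (σ : ι ≃ ι') (σ1 : ∀ i j, i ≠ j → (Arr i j ≃ Arr' (σ i) (σ j))),
    (∀ i j : ι, (∃ x, e i * x * e j ≠ 0) ↔ ∃ y, f (σ i) * y * f (σ j) ≠ 0) ∧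
    (∀ (i j : ι) (w : QPath Arr i j), GMem Λ e arr w →
      ∃ w' : QPath Arr' (σ i) (σ j),
        PathCorr σ (fun i j h => σ1 i j h) w w' ∧ GMem Γ f arr' w') ∧
    (∀ (i j : ι) (w' : QPath Arr' (σ i) (σ j)), GMem Γ f arr' w' →
      ∃ w : QPath Arr i j,
        PathCorr σ (fun i j h => σ1 i j h) w w' ∧ GMem Λ e arr w)

end TauTilting

namespace TauTilting

/-- The poset `P_{ℓ,ℓ'}` : two chains `s > x_1 > ⋯ > x_ℓ > t` and
`s > y_1 > ⋯ > y_{ℓ'} > t`, encoded on `Fin (ℓ+2) ⊕ Fin ℓ'` where `inl 0 = s`,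
`inl (ℓ+1) = t`, `inl k = x_k` for `1 ≤ k ≤ ℓ`, and `inr j = y_{j+1}`. -/
def Ple (ℓ ℓ' : ℕ) : (Fin (ℓ + 2) ⊕ Fin ℓ') → (Fin (ℓ + 2) ⊕ Fin ℓ') → Prop
  | Sum.inl a, Sum.inl b => b ≤ a
  | Sum.inl a, Sum.inr _ => a = Fin.last (ℓ + 1)
  | Sum.inr _, Sum.inl b => b = 0
  | Sum.inr j, Sum.inr m => m ≤ j

end TauTilting

namespace TauTilting

section Gen

variable {A : Type} [Ring A] {M N X Y : Type} [AddCommGroup M] [Module A M] [AddCommGroup N]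
  [Module A N] [AddCommGroup X] [Module A X] [AddCommGroup Y] [Module A Y]

/-- Unbundled version of `MemFac`: `X` is a factor of a finite direct sum of copies of `M`. -/
def Gen (A : Type) [Ring A] (M X : Type) [AddCommGroup M] [Module A M] [AddCommGroup X]
    [Module A X] : Prop :=
  ∃ (n : ℕ) (f : (Fin n → M) →ₗ[A] X), Function.Surjective f

theorem Gen.of_fintype {ι : Type} [Finite ι] (f : (ι → M) →ₗ[A] X)
    (hf : Function.Surjective f) : Gen A M X := by
  obtain ⟨n, ⟨c⟩⟩ := Finite.exists_equiv_fin ι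
  exact ⟨n, f ∘ₗ (LinearEquiv.funCongrLeft A M c).toLinearMap,
    hf.comp (LinearEquiv.funCongrLeft A M c).surjective⟩

theorem Gen.of_surjective (f : M →ₗ[A] X) (hf : Function.Surjective f) : Gen A M X :=
  Gen.of_fintype (ι := Unit) (f ∘ₗ LinearMap.proj ()) (hf.comp fun m => ⟨fun _ => m, rfl⟩)

theorem Gen.refl : Gen A M M := .of_surjective LinearMap.id Function.surjective_id

theorem Gen.of_subsingleton [Subsingleton X] : Gen A M X :=
  .of_surjective 0 fun _ => ⟨0, Subsingleton.elim _ _⟩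

theorem Gen.trans (h : Gen A M X) (h' : Gen A X Y) : Gen A M Y := by
  obtain ⟨n, f, hf⟩ := h
  obtain ⟨m, g, hg⟩ := h'
  refine Gen.of_fintype (ι := Fin m × Fin n) (g ∘ₗ LinearMap.pi fun i =>
    f ∘ₗ LinearMap.pi fun j => LinearMap.proj (i, j)) fun y => ?_
  obtain ⟨x, rfl⟩ := hg y
  choose u hu using fun i => hf (x i)
  exact ⟨fun p => u p.1 p.2, congrArg g (funext hu)⟩

theorem Gen.of_prod {P : Type} [AddCommGroup P] [Module A P] (hM : Gen A P M) (hN : Gen A P N) :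
    Gen A P (M × N) := by
  obtain ⟨m, f, hf⟩ := hM
  obtain ⟨n, g, hg⟩ := hN
  refine Gen.of_fintype (ι := Fin m ⊕ Fin n)
    ((f ∘ₗ LinearMap.funLeft A P Sum.inl).prod (g ∘ₗ LinearMap.funLeft A P Sum.inr))
    fun ⟨x, y⟩ => ?_
  obtain ⟨u, rfl⟩ := hf x
  obtain ⟨v, rfl⟩ := hg y
  exact ⟨Sum.elim u v, rfl⟩

theorem Gen.finite [Module.Finite A M] (h : Gen A M X) : Module.Finite A X := by
  obtain ⟨n, f, hf⟩ := h
  exact Module.Finite.of_surjective f hf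

theorem Gen.eq_top (h : Gen A M X) {N : Submodule A X} (hN : ∀ (f : M →ₗ[A] X) m, f m ∈ N) :
    N = ⊤ := by
  obtain ⟨n, f, hf⟩ := h
  refine eq_top_iff.2 fun x _ => ?_
  obtain ⟨u, rfl⟩ := hf x
  rw [← Finset.univ_sum_single u, map_sum]
  exact Submodule.sum_mem _ fun i _ => hN (f ∘ₗ LinearMap.single A (fun _ => M) i) (u i)

theorem Gen.hom_eq_zero (h : Gen A M X) (hY : ∀ f : M →ₗ[A] Y, f = 0) (g : X →ₗ[A] Y) :
    g = 0 := by
  refine LinearMap.ker_eq_top.1 (h.eq_top fun f m => ?_)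
  exact LinearMap.congr_fun (hY (g ∘ₗ f)) m

/-- A Noetherian module has a largest submodule generated by `M`. -/
theorem exists_trace (M X : Type) [AddCommGroup M] [Module A M] [AddCommGroup X] [Module A X]
    [IsNoetherian A X] :
    ∃ t : Submodule A X, Gen A M t ∧ ∀ (f : M →ₗ[A] X) m, f m ∈ t := by
  obtain ⟨t, ⟨n, g, rfl⟩, ht⟩ := set_has_maximal_iff_noetherian.2 ‹IsNoetherian A X›
    {t | ∃ (n : ℕ) (g : (Fin n → M) →ₗ[A] X), t = LinearMap.range g} ⟨_, 0, 0, rfl⟩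
  refine ⟨_, ⟨n, g.rangeRestrict, g.surjective_rangeRestrict⟩, fun f m => ?_⟩
  let g' : (Fin (n + 1) → M) →ₗ[A] X :=
    f ∘ₗ LinearMap.proj 0 + g ∘ₗ LinearMap.pi fun i => LinearMap.proj i.succ
  have hle : LinearMap.range g ≤ LinearMap.range g' := by
    rintro _ ⟨u, rfl⟩
    refine ⟨Fin.cons 0 u, ?_⟩
    simp only [g', LinearMap.add_apply, LinearMap.comp_apply, LinearMap.proj_apply,
      Fin.cons_zero, map_zero, zero_add]
    congr 1
  have hge := not_lt_iff_le_imp_ge.1 (ht _ ⟨_, g', rfl⟩) hle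
  refine hge ⟨Fin.cons m 0, ?_⟩
  simp only [g', LinearMap.add_apply, LinearMap.comp_apply, LinearMap.proj_apply, Fin.cons_zero]
  rw [add_eq_left]
  convert map_zero g
  rfl

theorem Gen.of_span [IsNoetherian A X] {U : Set X} (hU : Submodule.span A U = ⊤)
    (h : ∀ u ∈ U, ∃ (f : M →ₗ[A] X) (m : M), f m = u) : Gen A M X := by
  obtain ⟨t, ht, hft⟩ := exists_trace (A := A) M X
  have : t = ⊤ := by
    rw [eq_top_iff, ← hU, Submodule.span_le]
    intro u hu
    obtain ⟨f, m, rfl⟩ := h u hu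
    exact hft f m
  subst this
  exact ht.trans (.of_surjective _ (LinearEquiv.surjective Submodule.topEquiv))

end Gen

section Ext

variable {A : Type} [Ring A]

/-- If `Ext¹(M, X) = 0`, maps from `M` lift along extensions by `X`. -/
theorem Ext1Vanish.lift {M X : Mdl A} (h : Ext1Vanish M X) {E Y : Type} [AddCommGroup E]
    [Module A E] [AddCommGroup Y] [Module A Y] (f : X →ₗ[A] E) (g : E →ₗ[A] Y)
    (hf : Function.Injective f) (hg : Function.Surjective g)
    (hfg : LinearMap.range f = LinearMap.ker g) (φ : M →ₗ[A] Y) :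
    ∃ s : M →ₗ[A] E, g ∘ₗ s = φ := by
  let P : Submodule A (M × E) :=
    LinearMap.ker (φ ∘ₗ LinearMap.fst A M E - g ∘ₗ LinearMap.snd A M E)
  have memP : ∀ z : M × E, z ∈ P ↔ φ z.1 = g z.2 := fun z => by
    simp [P, LinearMap.mem_ker, sub_eq_zero]
  have hgf : ∀ x, g (f x) = 0 := fun x => by
    have : f x ∈ LinearMap.range f := ⟨x, rfl⟩
    rwa [hfg] at this
  obtain ⟨s, hs⟩ := h (ModuleCat.of A P)
    ((LinearMap.inr A M E ∘ₗ f).codRestrict P fun x => by simp [memP, hgf])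
    (LinearMap.fst A M E ∘ₗ P.subtype)
    (fun x y hxy => hf (congrArg (fun z : P => z.1.2) hxy))
    (fun m => by
      obtain ⟨w, hw⟩ := hg (φ m)
      exact ⟨⟨(m, w), by simp [memP, hw]⟩, rfl⟩)
    (by
      ext z
      obtain ⟨⟨m, w⟩, hz⟩ := z
      rw [memP] at hz
      constructor
      · rintro ⟨x, hx⟩
        have := congrArg (fun z : P => z.1.1) hx
        exact this.symm
      · intro hm
        have hm : m = 0 := hm
        subst hm
        have : w ∈ LinearMap.ker g := by simpa using hz.symm
        rw [← hfg] at this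
        obtain ⟨x, rfl⟩ := this
        exact ⟨x, rfl⟩)
  refine ⟨LinearMap.snd A M E ∘ₗ P.subtype ∘ₗ s, LinearMap.ext fun m => ?_⟩
  have h1 := (memP _).1 (s m).2
  have h2 : (s m).1.1 = m := LinearMap.congr_fun hs m
  rw [h2] at h1
  exact h1.symm

theorem Ext1Vanish.dsum {M N X : Mdl A} (hM : Ext1Vanish M X) (hN : Ext1Vanish N X) :
    Ext1Vanish (dsum M N) X := by
  intro E f g hf hg hfg
  let g' : E →ₗ[A] M × N := g
  obtain ⟨s, hs⟩ := hM.lift f g' hf hg hfg (LinearMap.inl A M N)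
  obtain ⟨r, hr⟩ := hN.lift f g' hf hg hfg (LinearMap.inr A M N)
  refine ⟨(LinearMap.coprod s r : M × N →ₗ[A] E), ?_⟩
  change g' ∘ₗ LinearMap.coprod s r = LinearMap.id
  rw [LinearMap.comp_coprod, hs, hr, LinearMap.coprod_inl_inr]

/-- For a `τ`-rigid module `M`, the quotient of a Noetherian module by its `M`-trace is
torsion-free. -/
theorem IsTauRigid.exists_torsionFree_quotient {M : Mdl A} (hM : IsTauRigid M) (R : Type)
    [AddCommGroup R] [Module A R] [IsNoetherian A R] (hR : ¬ Gen A M R) :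
    ∃ t : Submodule A R, Nontrivial (R ⧸ t) ∧ ∀ f : M →ₗ[A] R ⧸ t, f = 0 := by
  obtain ⟨t, ht, hft⟩ := exists_trace (A := A) M R
  refine ⟨t, Submodule.Quotient.nontrivial_iff.2 ?_, fun φ => ?_⟩
  · rintro rfl
    exact hR (ht.trans (.of_surjective _ (LinearEquiv.surjective Submodule.topEquiv)))
  · obtain ⟨s, hs⟩ := (hM.2 (ModuleCat.of A t) ht).lift t.subtype t.mkQ
      (Submodule.subtype_injective t) (Submodule.mkQ_surjective t) (by simp) φ
    rw [← hs]
    ext m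
    exact (Submodule.Quotient.mk_eq_zero t).2 (hft s m)

end Ext

section Decomposition

variable {A : Type} [Ring A]

theorem IsIndec.of_equiv {M N : Type} [AddCommGroup M] [Module A M] [AddCommGroup N] [Module A N]
    (c : M ≃ₗ[A] N) (h : IsIndec (ModuleCat.of A M)) : IsIndec (ModuleCat.of A N) := by
  have hnt : Nontrivial M := h.1
  refine ⟨c.symm.toEquiv.nontrivial, fun U V hUV => ?_⟩
  let o : Submodule A M ≃o Submodule A N := Submodule.orderIsoMapComap c
  have := h.2 (o.symm U) (o.symm V) (o.symm.isCompl hUV)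
  simpa only [map_eq_bot_iff] using this

theorem isDecompOf_single {M : Mdl A} (h : IsIndec M) :
    IsDecompOf M (fun _ : Fin 1 => (⊤ : Submodule A M)) := by
  refine ⟨?_, by simp, fun _ => IsIndec.of_equiv Submodule.topEquiv.symm h⟩
  intro i
  simp [Subsingleton.elim _ i]

theorem isDecompOf_of_isCompl {M : Mdl A} {U V : Submodule A M} (hUV : IsCompl U V)
    (hU : IsIndec (ModuleCat.of A U)) (hV : IsIndec (ModuleCat.of A V)) :
    IsDecompOf M (fun i : Fin 2 => if i = 0 then U else V) := by
  refine ⟨?_, ?_, ?_⟩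
  · intro i
    fin_cases i
    · refine hUV.disjoint.mono_right (iSup₂_le fun j hj => ?_)
      fin_cases j
      · exact (hj rfl).elim
      · exact le_rfl
    · refine hUV.symm.disjoint.mono_right (iSup₂_le fun j hj => ?_)
      fin_cases j
      · exact le_rfl
      · exact (hj rfl).elim
  · rw [← hUV.sup_eq_top]
    apply le_antisymm
    · refine iSup_le fun j => ?_
      fin_cases j
      · exact le_sup_left
      · exact le_sup_right
    · exact sup_le (le_iSup_of_le 0 le_rfl) (le_iSup_of_le 1 le_rfl)
  · intro i
    fin_cases i
    · exact hU
    · exact hV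

theorem isDecompOf_dsum {M N : Mdl A} (hM : IsIndec M) (hN : IsIndec N) :
    IsDecompOf (dsum M N) (fun i : Fin 2 => if i = 0 then LinearMap.range (LinearMap.inl A M N)
      else LinearMap.range (LinearMap.inr A M N)) :=
  isDecompOf_of_isCompl (M := dsum M N) LinearMap.isCompl_range_inl_inr
    (IsIndec.of_equiv (LinearEquiv.ofInjective _ LinearMap.inl_injective) hM)
    (IsIndec.of_equiv (LinearEquiv.ofInjective _ LinearMap.inr_injective) hN)

theorem isBasicMod_dsum {M N : Mdl A} (hM : IsIndec M) (hN : IsIndec N)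
    (h : IsEmpty (M ≃ₗ[A] N)) : IsBasicMod (dsum M N) := by
  refine ⟨2, _, isDecompOf_dsum hM hN, fun k l hkl => ⟨fun c => ?_⟩⟩
  have e₁ := LinearEquiv.ofInjective (LinearMap.inl A M N) LinearMap.inl_injective
  have e₂ := LinearEquiv.ofInjective (LinearMap.inr A M N) LinearMap.inr_injective
  fin_cases k <;> fin_cases l
  · exact hkl rfl
  · exact h.false (e₁.trans (c.trans e₂.symm))
  · exact h.false (e₁.trans (c.symm.trans e₂.symm))
  · exact hkl rfl

theorem isBasicMod_single {M : Mdl A} (h : IsIndec M) : IsBasicMod M :=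
  ⟨1, _, isDecompOf_single h, fun k l hkl => (hkl (Subsingleton.elim k l)).elim⟩

end Decomposition

/-- The product `F * α 0 * ⋯ * α (i - 1)`. -/
def armPath {A : Type} [Ring A] (F : A) (α : ℕ → A) : ℕ → A
  | 0 => F
  | i + 1 => armPath F α i * α i

/-- The product `α m * ⋯ * α (m + d - 1)`. -/
def armSeg {A : Type} [Ring A] (α : ℕ → A) : ℕ → ℕ → A
  | _, 0 => 1
  | m, d + 1 => α m * armSeg α (m + 1) d

theorem armPath_mul_armSeg {A : Type} [Ring A] (F : A) (α : ℕ → A) (m d : ℕ) :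
    armPath F α m * armSeg α m d = armPath F α (m + d) := by
  induction d generalizing m with
  | zero => rw [armSeg, mul_one, add_zero]
  | succ d ih => rw [armSeg, ← mul_assoc, ← armPath, ih, Nat.succ_add_eq_add_succ]

/-- The generators and relations of the opposite of `Λ^{(n+1,n'+1)}`: a `K`-algebra generated by
orthogonal idempotents `E`, `F` and two families of arrows, extended by zero to all natural
numbers. -/
structure TwoArmedRel (K : Type) {A : Type} [Field K] [Ring A] [Algebra K A] (E F : A)
    (α β : ℕ → A) (n n' : ℕ) : Prop where
  E_mul_E : E * E = E
  F_mul_F : F * F = F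
  E_mul_F : E * F = 0
  F_mul_E : F * E = 0
  E_add_F : E + F = 1
  E_ne : E ≠ 0
  F_ne : F ≠ 0
  α_zero : F * α 0 * E = α 0
  α_succ : ∀ k, E * α (k + 1) * E = α (k + 1)
  β_zero : E * β 0 * F = β 0
  β_succ : ∀ k, F * β (k + 1) * F = β (k + 1)
  α_eq_zero : ∀ k, n ≤ k → α k = 0
  β_eq_zero : ∀ k, n' ≤ k → β k = 0
  α_mul_α : ∀ k l, l ≠ k + 1 → α k * α l = 0
  β_mul_β : ∀ k l, l ≠ k + 1 → β k * β l = 0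
  α_mul_β : ∀ k l, α k * β l = 0
  β_mul_α : ∀ k l, β k * α l = 0
  adjoin_eq_top : Algebra.adjoin K ({E, F} ∪ Set.range α ∪ Set.range β) = ⊤

/-- The opposite of `Λ^{(n+1,n'+1)}`: the relations of `TwoArmedRel`, and the paths starting with
the arrows between the two vertices are linearly independent. -/
structure TwoArmed (K : Type) {A : Type} [Field K] [Ring A] [Algebra K A] (E F : A)
    (α β : ℕ → A) (n n' : ℕ) : Prop extends TwoArmedRel K E F α β n n' where
  α_indep : ∀ j < n, armPath F α (j + 1) ∉
    Submodule.span K {x | ∃ i, 1 ≤ i ∧ i ≤ j ∧ x = armPath F α i}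
  β_indep : ∀ j < n', armPath E β (j + 1) ∉
    Submodule.span K {x | ∃ i, 1 ≤ i ∧ i ≤ j ∧ x = armPath E β i}

/-- The `K`-span of `α k • m` and `β k • m`, i.e. the radical of the module `X`. -/
def radSpan (K : Type) {A : Type} [Field K] [Ring A] (α β : ℕ → A) (X : Type) [AddCommGroup X]
    [Module A X] [Module K X] : Submodule K X :=
  Submodule.span K {y | ∃ k, ∃ m : X, y = α k • m ∨ y = β k • m}

/-- The span of the radical of `X` and `F • X`; it is proper when the simple module at the other
vertex is a quotient of `X`. -/
def coTop (K : Type) {A : Type} [Field K] [Ring A] (F : A) (α β : ℕ → A) (X : Type)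
    [AddCommGroup X] [Module A X] [Module K X] : Submodule K X :=
  radSpan K α β X ⊔ Submodule.span K (Set.range fun m : X => F • m)

theorem radSpan_comm {K : Type} {A : Type} [Field K] [Ring A] (α β : ℕ → A) (X : Type)
    [AddCommGroup X] [Module A X] [Module K X] : radSpan K α β X = radSpan K β α X := by
  simp only [radSpan, or_comm]

theorem coTop_comm {K : Type} {A : Type} [Field K] [Ring A] (F : A) (α β : ℕ → A) (X : Type)
    [AddCommGroup X] [Module A X] [Module K X] : coTop K F α β X = coTop K F β α X := by
  rw [coTop, coTop, radSpan_comm]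

theorem α_smul_mem_radSpan {K A : Type} [Field K] [Ring A] {α β : ℕ → A} {X : Type}
    [AddCommGroup X] [Module A X] [Module K X] (k : ℕ) (x : X) : α k • x ∈ radSpan K α β X :=
  Submodule.subset_span ⟨k, x, .inl rfl⟩

theorem β_smul_mem_radSpan {K A : Type} [Field K] [Ring A] {α β : ℕ → A} {X : Type}
    [AddCommGroup X] [Module A X] [Module K X] (k : ℕ) (x : X) : β k • x ∈ radSpan K α β X :=
  Submodule.subset_span ⟨k, x, .inr rfl⟩

namespace TwoArmedRel

variable {K A : Type} [Field K] [Ring A] [Algebra K A] {E F : A} {α β : ℕ → A} {n n' : ℕ}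

theorem swap (h : TwoArmedRel K E F α β n n') : TwoArmedRel K F E β α n' n where
  E_mul_E := h.F_mul_F
  F_mul_F := h.E_mul_E
  E_mul_F := h.F_mul_E
  F_mul_E := h.E_mul_F
  E_add_F := by rw [add_comm, h.E_add_F]
  E_ne := h.F_ne
  F_ne := h.E_ne
  α_zero := h.β_zero
  α_succ := h.β_succ
  β_zero := h.α_zero
  β_succ := h.α_succ
  α_eq_zero := h.β_eq_zero
  β_eq_zero := h.α_eq_zero
  α_mul_α := h.β_mul_β
  β_mul_β := h.α_mul_α
  α_mul_β := h.β_mul_α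
  β_mul_α := h.α_mul_β
  adjoin_eq_top := by
    rw [← h.adjoin_eq_top, Set.pair_comm, Set.union_assoc, Set.union_assoc,
      Set.union_comm (Set.range β)]

theorem α_mul_E (h : TwoArmedRel K E F α β n n') (k : ℕ) : α k * E = α k := by
  cases k with
  | zero => rw [← h.α_zero, mul_assoc, h.E_mul_E]
  | succ k => rw [← h.α_succ, mul_assoc, h.E_mul_E]

theorem α_mul_F (h : TwoArmedRel K E F α β n n') (k : ℕ) : α k * F = 0 := by
  rw [← h.α_mul_E, mul_assoc, h.E_mul_F, mul_zero]

theorem F_mul_α_zero (h : TwoArmedRel K E F α β n n') : F * α 0 = α 0 := by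
  rw [← h.α_zero, ← mul_assoc, ← mul_assoc, h.F_mul_F]

theorem E_mul_α_zero (h : TwoArmedRel K E F α β n n') : E * α 0 = 0 := by
  rw [← h.F_mul_α_zero, ← mul_assoc, h.E_mul_F, zero_mul]

theorem E_mul_α_succ (h : TwoArmedRel K E F α β n n') (k : ℕ) : E * α (k + 1) = α (k + 1) := by
  rw [← h.α_succ, ← mul_assoc, ← mul_assoc, h.E_mul_E]

theorem F_mul_α_succ (h : TwoArmedRel K E F α β n n') (k : ℕ) : F * α (k + 1) = 0 := by
  rw [← h.E_mul_α_succ, ← mul_assoc, h.F_mul_E, zero_mul]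

section Modules

variable {X : Type} [AddCommGroup X] [Module A X]

theorem E_smul (h : TwoArmedRel K E F α β n n') (x : X) : E • x = x - F • x := by
  rw [eq_sub_iff_add_eq, ← add_smul, h.E_add_F, one_smul]

theorem F_smul (h : TwoArmedRel K E F α β n n') (x : X) : F • x = x - E • x := h.swap.E_smul x

variable [Module K X] [IsScalarTower K A X]

theorem smul_mem_of_stable (h : TwoArmedRel K E F α β n n') {Y : Submodule K X}
    (hF : ∀ x ∈ Y, F • x ∈ Y) (hα : ∀ k, ∀ x ∈ Y, α k • x ∈ Y) (hβ : ∀ k, ∀ x ∈ Y, β k • x ∈ Y)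
    (a : A) : ∀ x ∈ Y, a • x ∈ Y := by
  have ha : a ∈ Algebra.adjoin K ({E, F} ∪ Set.range α ∪ Set.range β) := by
    rw [h.adjoin_eq_top]; trivial
  induction ha using Algebra.adjoin_induction with
  | mem a ha =>
    rcases ha with (⟨rfl | rfl⟩ | ⟨k, rfl⟩) | ⟨k, rfl⟩
    · intro x hx
      rw [h.E_smul]
      exact Y.sub_mem hx (hF x hx)
    · simp_all
    · exact hα k
    · exact hβ k
  | algebraMap r =>
    intro x hx
    rw [algebraMap_smul]
    exact Y.smul_mem r hx
  | add a b _ _ ha hb =>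
    intro x hx
    rw [add_smul]
    exact Y.add_mem (ha x hx) (hb x hx)
  | mul a b _ _ ha hb =>
    intro x hx
    rw [mul_smul]
    exact ha _ (hb x hx)

theorem eq_top_of_stable (h : TwoArmedRel K E F α β n n') {U : Set X}
    (hU : Submodule.span A U = ⊤) {Y : Submodule K X} (hUY : U ⊆ Y)
    (hF : ∀ x ∈ Y, F • x ∈ Y) (hα : ∀ k, ∀ x ∈ Y, α k • x ∈ Y) (hβ : ∀ k, ∀ x ∈ Y, β k • x ∈ Y) :
    Y = ⊤ := by
  refine eq_top_iff.2 fun x _ => ?_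
  have hx : x ∈ Submodule.span A U := by rw [hU]; trivial
  induction hx using Submodule.span_induction with
  | mem x hx => exact hUY hx
  | zero => exact Y.zero_mem
  | add x y _ _ hx hy => exact Y.add_mem (hx trivial) (hy trivial)
  | smul a x _ hx => exact h.smul_mem_of_stable hF hα hβ a x (hx trivial)

end Modules

end TwoArmedRel

namespace TwoArmed

variable {K A : Type} [Field K] [Ring A] [Algebra K A] {E F : A} {α β : ℕ → A} {n n' : ℕ}

theorem swap (h : TwoArmed K E F α β n n') : TwoArmed K F E β α n' n where
  toTwoArmedRel := h.toTwoArmedRel.swap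
  α_indep := h.β_indep
  β_indep := h.α_indep

theorem armPath_mul_α (h : TwoArmed K E F α β n n') (i k : ℕ) :
    armPath F α i * α k = if i = k then armPath F α (k + 1) else 0 := by
  split_ifs with hik
  · rw [hik]; rfl
  · cases i with
    | zero =>
      obtain ⟨k, rfl⟩ := Nat.exists_eq_succ_of_ne_zero (Ne.symm hik)
      exact h.F_mul_α_succ k
    | succ i => rw [armPath, mul_assoc, h.α_mul_α _ _ (Ne.symm hik), mul_zero]

theorem armPath_mul_E (h : TwoArmed K E F α β n n') (i : ℕ) :
    armPath F α (i + 1) * E = armPath F α (i + 1) := by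
  rw [armPath, mul_assoc, h.α_mul_E]

theorem armPath_mul_F (h : TwoArmed K E F α β n n') (i : ℕ) : armPath F α (i + 1) * F = 0 := by
  rw [armPath, mul_assoc, h.α_mul_F, mul_zero]

theorem F_mul_armPath (h : TwoArmed K E F α β n n') (i : ℕ) :
    F * armPath F α i = armPath F α i := by
  induction i with
  | zero => exact h.F_mul_F
  | succ i ih => rw [armPath, ← mul_assoc, ih]

theorem E_mul_armPath (h : TwoArmed K E F α β n n') (i : ℕ) : E * armPath F α i = 0 := by
  rw [← h.F_mul_armPath, ← mul_assoc, h.E_mul_F, zero_mul]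

theorem α_mul_armPath (h : TwoArmed K E F α β n n') (k i : ℕ) : α k * armPath F α i = 0 := by
  rw [← h.F_mul_armPath, ← mul_assoc, h.α_mul_F, zero_mul]

theorem β_mul_armPath (h : TwoArmed K E F α β n n') (k i : ℕ) : β k * armPath F α (i + 1) = 0 := by
  induction i with
  | zero => rw [armPath, armPath, h.F_mul_α_zero, h.β_mul_α]
  | succ i ih => rw [armPath, ← mul_assoc, ih, zero_mul]

theorem armPath_eq_zero (h : TwoArmed K E F α β n n') (i : ℕ) (hi : n < i) : armPath F α i = 0 := by
  obtain ⟨i, rfl⟩ := Nat.exists_eq_add_one_of_ne_zero (by omega : i ≠ 0)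
  rw [armPath, h.α_eq_zero i (by omega), mul_zero]

theorem armPath_mul_armSeg_of_ne (h : TwoArmed K E F α β n n') {i m : ℕ} (him : i ≠ m) (d : ℕ) :
    armPath F α i * armSeg α m (d + 1) = 0 := by
  rw [armSeg, ← mul_assoc, h.armPath_mul_α, if_neg him, zero_mul]

section Modules

variable {X : Type} [AddCommGroup X] [Module A X]

theorem β_smul_eq_zero (h : TwoArmed K E F α β n n') {x : X} (hx : F • x = 0) (k : ℕ) :
    β k • x = 0 := by
  rw [← h.swap.α_mul_E, mul_smul, hx, smul_zero]

variable [Module K X] [IsScalarTower K A X]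

theorem exists_linearMap {Z : Type} [AddCommGroup Z] [Module A Z] [Module K Z]
    [IsScalarTower K A Z] (h : TwoArmed K E F α β n n') (f : X →ₗ[K] Z)
    (hF : ∀ x, f (F • x) = F • f x) (hα : ∀ k x, f (α k • x) = α k • f x)
    (hβ : ∀ k x, f (β k • x) = β k • f x) : ∃ g : X →ₗ[A] Z, ∀ x, g x = f x := by
  suffices H : ∀ (a : A) x, f (a • x) = a • f x from
    ⟨{ toFun := f, map_add' := f.map_add, map_smul' := H }, fun _ => rfl⟩
  intro a
  have ha : a ∈ Algebra.adjoin K ({E, F} ∪ Set.range α ∪ Set.range β) := by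
    rw [h.adjoin_eq_top]; trivial
  induction ha using Algebra.adjoin_induction with
  | mem a ha =>
    rcases ha with (⟨rfl | rfl⟩ | ⟨k, rfl⟩) | ⟨k, rfl⟩
    · intro x
      rw [h.E_smul, h.E_smul, map_sub, hF]
    · simp_all
    · exact hα k
    · exact hβ k
  | algebraMap r => intro x; rw [algebraMap_smul, algebraMap_smul, f.map_smul]
  | add a b _ _ ha hb => intro x; rw [add_smul, add_smul, map_add, ha, hb]
  | mul a b _ _ ha hb => intro x; rw [mul_smul, mul_smul, ha, hb]

theorem F_smul_mem_radSpan (h : TwoArmed K E F α β n n') (x : X) (hx : x ∈ radSpan K α β X) :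
    F • x ∈ radSpan K α β X := by
  induction hx using Submodule.span_induction with
  | mem x hx =>
    obtain ⟨k, m, rfl | rfl⟩ := hx
    · cases k with
      | zero => rw [← mul_smul, h.F_mul_α_zero]; exact α_smul_mem_radSpan _ _
      | succ k => rw [← mul_smul, h.F_mul_α_succ, zero_smul]; exact zero_mem _
    · cases k with
      | zero => rw [← mul_smul, h.swap.E_mul_α_zero, zero_smul]; exact zero_mem _
      | succ k => rw [← mul_smul, h.swap.E_mul_α_succ]; exact β_smul_mem_radSpan _ _
  | zero => rw [smul_zero]; exact zero_mem _
  | add x y _ _ hx hy => rw [smul_add]; exact add_mem hx hy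
  | smul c x _ hx => rw [smul_algebra_smul_comm]; exact Submodule.smul_mem _ _ hx

theorem smul_mem_radSpan (h : TwoArmed K E F α β n n') (a : A) (x : X)
    (hx : x ∈ radSpan K α β X) : a • x ∈ radSpan K α β X :=
  h.smul_mem_of_stable h.F_smul_mem_radSpan (fun k x _ => α_smul_mem_radSpan k x)
    (fun k x _ => β_smul_mem_radSpan k x) a x hx

/-- Nakayama's lemma. -/
theorem eq_top_of_sup_radSpan (h : TwoArmed K E F α β n n') (N : Submodule A X)
    (hN : ∀ x, ∃ y ∈ N, x - y ∈ radSpan K α β X) : N = ⊤ := by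
  have key : ∀ {E F : A} {α β : ℕ → A} {n n' : ℕ}, TwoArmed K E F α β n n' →
      (∀ x, ∃ y ∈ N, x - y ∈ radSpan K α β X) → ∀ d k, n ≤ k + d → ∀ x : X, α k • x ∈ N := by
    intro E F α β n n' h hN d
    induction d with
    | zero => intro k hk x; rw [h.α_eq_zero k hk, zero_smul]; exact N.zero_mem
    | succ d ih =>
      intro k hk x
      obtain ⟨y, hy, hxy⟩ := hN x
      have : ∀ z ∈ radSpan K α β X, α k • z ∈ N := by
        intro z hz
        induction hz using Submodule.span_induction with
        | mem z hz =>
          obtain ⟨l, m, rfl | rfl⟩ := hz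
          · by_cases hl : l = k + 1
            · exact N.smul_mem _ (ih l (by omega) m)
            · rw [← mul_smul, h.α_mul_α k l hl, zero_smul]; exact N.zero_mem
          · rw [← mul_smul, h.α_mul_β, zero_smul]; exact N.zero_mem
        | zero => rw [smul_zero]; exact N.zero_mem
        | add x y _ _ hx hy => rw [smul_add]; exact N.add_mem hx hy
        | smul c x _ hx =>
          rw [smul_algebra_smul_comm, ← algebraMap_smul A c]; exact N.smul_mem _ hx
      have := N.add_mem (this _ hxy) (N.smul_mem (α k) hy)
      rwa [← smul_add, sub_add_cancel] at this
  have hN' : ∀ x, ∃ y ∈ N, x - y ∈ radSpan K β α X := by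
    simpa only [radSpan_comm (K := K) β α] using hN
  refine eq_top_iff.2 fun x _ => ?_
  obtain ⟨y, hy, hxy⟩ := hN x
  have : ∀ z ∈ radSpan K α β X, z ∈ N := by
    intro z hz
    induction hz using Submodule.span_induction with
    | mem z hz =>
      obtain ⟨l, m, rfl | rfl⟩ := hz
      · exact key h hN n l (by omega) m
      · exact key h.swap hN' n' l (by omega) m
    | zero => exact N.zero_mem
    | add x y _ _ hx hy => exact N.add_mem hx hy
    | smul c x _ hx => rw [← algebraMap_smul A c]; exact N.smul_mem _ hx
  simpa using N.add_mem (this _ hxy) hy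

theorem radSpan_ne_top (h : TwoArmed K E F α β n n') [Nontrivial X] :
    radSpan K α β X ≠ ⊤ := fun ht =>
  bot_ne_top (h.eq_top_of_sup_radSpan (⊥ : Submodule A X) fun x =>
    ⟨0, zero_mem _, by rw [ht]; trivial⟩)

end Modules

section Socle

variable {X : Type} [AddCommGroup X] [Module A X]

theorem exists_socle_of_α_smul_ne (h : TwoArmed K E F α β n n') (k : ℕ) (x : X)
    (hx : α k • x ≠ 0) : ∃ y : X, y ≠ 0 ∧ (∀ k, α k • y = 0) ∧ ∀ k, β k • y = 0 := by
  have hβ : ∀ l, β l • α k • x = 0 := fun l => by rw [← mul_smul, h.β_mul_α, zero_smul]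
  induction k generalizing x with
  | zero =>
    refine ⟨_, hx, fun l => ?_, hβ⟩
    rw [← mul_smul, h.α_mul_α l 0 (by omega), zero_smul]
  | succ k ih =>
    by_cases hk : α k • α (k + 1) • x = 0
    · refine ⟨_, hx, fun l => ?_, hβ⟩
      by_cases hl : k = l
      · rw [← hl, hk]
      · rw [← mul_smul, h.α_mul_α l (k + 1) (by omega), zero_smul]
    · exact ih _ hk fun l => by rw [← mul_smul, h.β_mul_α, zero_smul]

theorem exists_socle (h : TwoArmed K E F α β n n') [Nontrivial X] :
    ∃ y : X, y ≠ 0 ∧ (∀ k, α k • y = 0) ∧ (∀ k, β k • y = 0) ∧ (F • y = 0 ∨ E • y = 0) := by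
  have : ∃ y : X, y ≠ 0 ∧ (∀ k, α k • y = 0) ∧ ∀ k, β k • y = 0 := by
    obtain ⟨x, hx⟩ := exists_ne (0 : X)
    by_cases hα : ∀ k, α k • x = 0
    · by_cases hβ : ∀ k, β k • x = 0
      · exact ⟨x, hx, hα, hβ⟩
      · push Not at hβ
        obtain ⟨k, hk⟩ := hβ
        obtain ⟨y, h0, h1, h2⟩ := h.swap.exists_socle_of_α_smul_ne k x hk
        exact ⟨y, h0, h2, h1⟩
    · push Not at hα
      obtain ⟨k, hk⟩ := hα
      exact h.exists_socle_of_α_smul_ne k x hk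
  obtain ⟨y, hy, hα, hβ⟩ := this
  by_cases hE : E • y = 0
  · exact ⟨y, hy, hα, hβ, .inr hE⟩
  · refine ⟨E • y, hE, fun k => ?_, fun k => ?_, .inl ?_⟩
    · rw [← mul_smul, h.α_mul_E, hα]
    · rw [← mul_smul, h.swap.α_mul_F, zero_smul]
    · rw [← mul_smul, h.F_mul_E, zero_smul]

variable [Module K X] [IsScalarTower K A X] {Q : Type} [AddCommGroup Q] [Module A Q]
  [Module K Q] [IsScalarTower K A Q]

/-- If `X` has a simple top at the vertex of `E`, it maps onto a simple submodule there. -/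
theorem exists_hom_ne_zero (h : TwoArmed K E F α β n n')
    (hX : coTop K F α β X ≠ ⊤) {y : Q}
    (hy : y ≠ 0) (hα : ∀ k, α k • y = 0) (hβ : ∀ k, β k • y = 0) (hF : F • y = 0) :
    ∃ f : X →ₗ[A] Q, f ≠ 0 := by
  obtain ⟨m, hm⟩ := SetLike.exists_not_mem_of_ne_top _ hX rfl
  obtain ⟨φ, hφm, hφ⟩ := Submodule.exists_le_ker_of_notMem hm
  have hφα : ∀ k m, φ (α k • m) = 0 := fun k m =>
    hφ (Submodule.mem_sup_left (α_smul_mem_radSpan k m))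
  have hφβ : ∀ k m, φ (β k • m) = 0 := fun k m =>
    hφ (Submodule.mem_sup_left (β_smul_mem_radSpan k m))
  have hφF : ∀ m, φ (F • m) = 0 := fun m =>
    hφ (Submodule.mem_sup_right (Submodule.subset_span ⟨m, rfl⟩))
  obtain ⟨g, hg⟩ := h.exists_linearMap (φ.smulRight y)
    (fun x => by simp [hφF, smul_algebra_smul_comm, hF])
    (fun k x => by simp [hφα, smul_algebra_smul_comm, hα])
    (fun k x => by simp [hφβ, smul_algebra_smul_comm, hβ])
  refine ⟨g, fun h0 => ?_⟩
  have := hg m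
  rw [h0] at this
  exact smul_ne_zero hφm hy this.symm

end Socle

end TwoArmed

section ArmMod

variable {A : Type} [Ring A]

/-- The quotient of `A` by the left ideal generated by `armPath F α i`, `i ≤ j`. -/
abbrev ArmMod (F : A) (α : ℕ → A) (j : ℕ) : Type :=
  A ⧸ Submodule.span A {x | ∃ i ≤ j, x = armPath F α i}

/-- The canonical generator of `ArmMod F α j`. -/
def ArmMod.gen (F : A) (α : ℕ → A) (j : ℕ) : ArmMod F α j :=
  Submodule.Quotient.mk 1

variable {F : A} {α : ℕ → A} {j : ℕ} {X : Type} [AddCommGroup X] [Module A X]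

theorem ArmMod.smul_gen (a : A) : a • gen F α j = Submodule.Quotient.mk a := by
  rw [gen, ← Submodule.Quotient.mk_smul, smul_eq_mul, mul_one]

theorem ArmMod.exists_smul_gen (x : ArmMod F α j) : ∃ a : A, a • gen F α j = x := by
  obtain ⟨a, rfl⟩ := Submodule.Quotient.mk_surjective _ x
  exact ⟨a, smul_gen a⟩

theorem ArmMod.armPath_smul_gen {i : ℕ} (hi : i ≤ j) : armPath F α i • gen F α j = 0 := by
  rw [smul_gen, Submodule.Quotient.mk_eq_zero]
  exact Submodule.subset_span ⟨i, hi, rfl⟩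

theorem ArmMod.exists_lift (x : X) (hx : ∀ i ≤ j, armPath F α i • x = 0) :
    ∃ f : ArmMod F α j →ₗ[A] X, f (gen F α j) = x := by
  refine ⟨Submodule.liftQ _ (LinearMap.toSpanSingleton A X x) ?_, ?_⟩
  · rw [Submodule.span_le]
    rintro _ ⟨i, hi, rfl⟩
    exact hx i hi
  · exact one_smul A x

theorem ArmMod.hom_ext {f g : ArmMod F α j →ₗ[A] X} (h : f (gen F α j) = g (gen F α j)) :
    f = g := by
  refine LinearMap.ext fun x => ?_
  obtain ⟨a, rfl⟩ := exists_smul_gen x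
  rw [map_smul, map_smul, h]

theorem Gen.span_armPath_eq_top (h : Gen A (ArmMod F α j) X) :
    Submodule.span A {x : X | ∀ i ≤ j, armPath F α i • x = 0} = ⊤ := by
  refine h.eq_top fun f m => ?_
  obtain ⟨a, rfl⟩ := ArmMod.exists_smul_gen m
  rw [map_smul]
  refine Submodule.smul_mem _ _ (Submodule.subset_span fun i hi => ?_)
  rw [← map_smul, ArmMod.armPath_smul_gen hi, map_zero]

theorem Gen.of_span_armPath [IsNoetherian A X]
    (h : Submodule.span A {x : X | ∀ i ≤ j, armPath F α i • x = 0} = ⊤) :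
    Gen A (ArmMod F α j) X :=
  .of_span h fun u hu => by
    obtain ⟨f, hf⟩ := ArmMod.exists_lift u hu
    exact ⟨f, _, hf⟩

theorem ArmMod.gen_of_le {i : ℕ} (hij : i ≤ j) : Gen A (ArmMod F α i) (ArmMod F α j) := by
  obtain ⟨f, hf⟩ := ArmMod.exists_lift (gen F α j)
    fun k (hk : k ≤ i) => armPath_smul_gen (F := F) (α := α) (hk.trans hij)
  refine .of_surjective f fun x => ?_
  obtain ⟨a, rfl⟩ := exists_smul_gen x
  exact ⟨a • gen F α i, by rw [map_smul, hf]⟩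

end ArmMod

namespace TwoArmed

variable {K A : Type} [Field K] [Ring A] [Algebra K A] {E F : A} {α β : ℕ → A} {n n' : ℕ}

section Modules

variable {X : Type} [AddCommGroup X] [Module A X] [Module K X] [IsScalarTower K A X]

theorem smul_of_span (h : TwoArmed K E F α β n n') {U : Set X} (hU : Submodule.span A U = ⊤)
    (hUF : ∀ u ∈ U, F • u = 0) (x : X) :
    (∀ i, armPath F α i • x ∈
      Submodule.span K {y | ∃ k, ∃ u ∈ U, y = armPath F α (k + 1) • u}) ∧
    ∀ k, β k • x = 0 := by
  let S : Submodule K X := Submodule.span K {y | ∃ k, ∃ u ∈ U, y = armPath F α (k + 1) • u}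
  let Y : Submodule K X :=
    { carrier := {x | (∀ i, armPath F α i • x ∈ S) ∧ ∀ k, β k • x = 0}
      zero_mem' := ⟨fun i => by rw [smul_zero]; exact zero_mem _, fun k => smul_zero _⟩
      add_mem' := fun hx hy => ⟨fun i => by rw [smul_add]; exact add_mem (hx.1 i) (hy.1 i),
        fun k => by rw [smul_add, hx.2, hy.2, add_zero]⟩
      smul_mem' := fun c x hx =>
        ⟨fun i => by rw [smul_algebra_smul_comm]; exact S.smul_mem c (hx.1 i),
          fun k => by rw [smul_algebra_smul_comm, hx.2, smul_zero]⟩ }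
  have hβS : ∀ k, ∀ x ∈ S, β k • x = 0 := by
    intro k x hx
    induction hx using Submodule.span_induction with
    | mem x hx =>
      obtain ⟨i, u, -, rfl⟩ := hx
      rw [← mul_smul, h.β_mul_armPath, zero_smul]
    | zero => exact smul_zero _
    | add x y _ _ hx hy => rw [smul_add, hx, hy, add_zero]
    | smul c x _ hx => rw [smul_algebra_smul_comm, hx, smul_zero]
  have hY : Y = ⊤ := by
    refine h.eq_top_of_stable hU (fun u hu => ⟨fun i => ?_, h.β_smul_eq_zero (hUF u hu)⟩)
      (fun x hx => ⟨fun i => ?_, fun k => hβS k _ (hx.1 0)⟩)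
      (fun k x hx => ⟨fun i => ?_, fun l => ?_⟩) (fun k x hx => ?_)
    · cases i with
      | zero => rw [armPath, hUF u hu]; exact zero_mem _
      | succ i => exact Submodule.subset_span ⟨i, u, hu, rfl⟩
    · rw [← mul_smul]
      cases i with
      | zero => rw [armPath, h.F_mul_F]; exact hx.1 0
      | succ i => rw [h.armPath_mul_F, zero_smul]; exact zero_mem _
    · rw [← mul_smul, h.armPath_mul_α]
      split_ifs
      · exact hx.1 _
      · rw [zero_smul]; exact zero_mem _
    · rw [← mul_smul, h.β_mul_α, zero_smul]
    · rw [hx.2 k]; exact Y.zero_mem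
  have : x ∈ Y := by rw [hY]; trivial
  exact this

/-- In a module generated by `ArmMod F α j`, the values of `armPath F α m`, `m ≤ j + 1`,
can be prescribed independently. -/
theorem exists_armPath_smul_eq (h : TwoArmed K E F α β n n') {j : ℕ}
    (hX : Gen A (ArmMod F α j) X) {m : ℕ} (hm : m ≤ j + 1) (z : X) (hz : F • z = z) :
    ∃ x : X, armPath F α m • x = z ∧ ∀ i ≤ j + 1, i ≠ m → armPath F α i • x = 0 := by
  have hzS := (h.smul_of_span hX.span_armPath_eq_top (fun u hu => hu 0 (Nat.zero_le j)) z).1 0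
  rw [armPath, hz] at hzS
  clear hz
  induction hzS using Submodule.span_induction with
  | mem z hz =>
    obtain ⟨k, u, hu, rfl⟩ := hz
    by_cases hk : k + 1 ≤ j
    · exact ⟨0, by rw [hu _ hk, smul_zero], fun _ _ _ => smul_zero _⟩
    · obtain ⟨d, hd⟩ := Nat.exists_eq_add_of_le (show m ≤ k + 1 by omega)
      refine ⟨armSeg α m d • u, by rw [← mul_smul, armPath_mul_armSeg, hd], fun i hi him => ?_⟩
      cases d with
      | zero => rw [armSeg, one_smul, hu i (by omega)]
      | succ d => rw [← mul_smul, h.armPath_mul_armSeg_of_ne him, zero_smul]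
  | zero => exact ⟨0, smul_zero _, fun _ _ _ => smul_zero _⟩
  | add z w _ _ hz hw =>
    obtain ⟨x, hx, hx'⟩ := hz
    obtain ⟨y, hy, hy'⟩ := hw
    exact ⟨x + y, by rw [smul_add, hx, hy],
      fun i hi him => by rw [smul_add, hx' i hi him, hy' i hi him, add_zero]⟩
  | smul c z _ hz =>
    obtain ⟨x, hx, hx'⟩ := hz
    exact ⟨c • x, by rw [smul_algebra_smul_comm, hx],
      fun i hi him => by rw [smul_algebra_smul_comm, hx' i hi him, smul_zero]⟩

end Modules

section TauRigid

theorem ext1Vanish_armMod_succ (h : TwoArmed K E F α β n n') {j : ℕ} {X : Mdl A}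
    (hX : Gen A (ArmMod F α j) X) : Ext1Vanish (ModuleCat.of A (ArmMod F α (j + 1))) X := by
  intro V f (g : V →ₗ[A] ArmMod F α (j + 1)) hf hg hfg
  let _ : Module K X := Module.compHom X (algebraMap K A)
  have : IsScalarTower K A X := ⟨fun c a x => by
    rw [Algebra.smul_def, mul_smul]; rfl⟩
  obtain ⟨y, hy⟩ := hg (ArmMod.gen F α (j + 1))
  have hz : ∀ i : Fin (j + 2), ∃ z, f z = armPath F α i • y := fun i => by
    have : armPath F α i • y ∈ LinearMap.ker g := by
      rw [LinearMap.mem_ker, map_smul, hy, ArmMod.armPath_smul_gen (by omega)]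
    rwa [← hfg] at this
  choose z hz using hz
  have hFz : ∀ i, F • z i = z i := fun i => hf (by
    rw [map_smul, hz, ← mul_smul, h.F_mul_armPath])
  choose x hx hx' using fun i : Fin (j + 2) =>
    h.exists_armPath_smul_eq hX (Nat.lt_succ_iff.1 i.2) (z i) (hFz i)
  obtain ⟨s, hs⟩ := ArmMod.exists_lift (F := F) (α := α) (j := j + 1) (y - f (∑ i, x i)) (by
    intro i hi
    rw [smul_sub, ← map_smul, Finset.smul_sum, sub_eq_zero,
      Finset.sum_eq_single ⟨i, by omega⟩ (fun l _ hl => hx' l i hi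
        fun hil => hl (Fin.ext hil.symm)) (by simp)]
    exact ((congrArg f (hx ⟨i, by omega⟩)).trans (hz _)).symm)
  have hgf : g (f (∑ i, x i)) = 0 := by
    rw [← LinearMap.mem_ker, ← hfg]
    exact ⟨_, rfl⟩
  exact ⟨s, ArmMod.hom_ext (by
    rw [LinearMap.comp_apply, hs, map_sub, hgf, sub_zero, hy, LinearMap.id_apply])⟩

theorem ext1Vanish_armMod_zero (h : TwoArmed K E F α β n n') (X : Mdl A) :
    Ext1Vanish (ModuleCat.of A (ArmMod F α 0)) X := by
  intro V f (g : V →ₗ[A] ArmMod F α 0) hf hg hfg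
  obtain ⟨y, hy⟩ := hg (ArmMod.gen F α 0)
  obtain ⟨s, hs⟩ := ArmMod.exists_lift (F := F) (α := α) (j := 0) (E • y) (by
    intro i hi
    rw [Nat.le_zero.1 hi, armPath, ← mul_smul, h.F_mul_E, zero_smul])
  refine ⟨s, ArmMod.hom_ext ?_⟩
  have := ArmMod.armPath_smul_gen (F := F) (α := α) (le_refl 0)
  rw [armPath] at this
  rw [LinearMap.comp_apply, hs, map_smul, hy, LinearMap.id_apply, h.E_smul, this, sub_zero]

theorem ext1Vanish_armMod (h : TwoArmed K E F α β n n') {i j : ℕ} (hij : i ≤ j + 1) {X : Mdl A}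
    (hX : Gen A (ArmMod F α j) X) : Ext1Vanish (ModuleCat.of A (ArmMod F α i)) X := by
  cases i with
  | zero => exact h.ext1Vanish_armMod_zero X
  | succ i => exact h.ext1Vanish_armMod_succ ((ArmMod.gen_of_le (by omega)).trans hX)

end TauRigid

end TwoArmed

namespace TwoArmed

variable {K A : Type} [Field K] [Ring A] [Algebra K A] {E F : A} {α β : ℕ → A} {n n' : ℕ}

theorem mul_E_mem_span (h : TwoArmed K E F α β n n') {j : ℕ} {a : A}
    (ha : a ∈ Submodule.span A {x | ∃ i ≤ j, x = armPath F α i}) :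
    a * E ∈ Submodule.span K {x | ∃ i, 1 ≤ i ∧ i ≤ j ∧ x = armPath F α i} := by
  have hS : ∀ {b : A} {c : K}, (∀ i, b * armPath F α (i + 1) = c • armPath F α (i + 1)) →
      ∀ x ∈ Submodule.span K {x | ∃ i, 1 ≤ i ∧ i ≤ j ∧ x = armPath F α i},
        b • x ∈ Submodule.span K {x | ∃ i, 1 ≤ i ∧ i ≤ j ∧ x = armPath F α i} := by
    intro b c hb x hx
    induction hx using Submodule.span_induction with
    | mem x hx =>
      obtain ⟨i, hi, hij, rfl⟩ := hx
      obtain ⟨i, rfl⟩ := Nat.exists_eq_add_of_le' hi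
      rw [smul_eq_mul, hb]
      exact Submodule.smul_mem _ _ (Submodule.subset_span ⟨_, hi, hij, rfl⟩)
    | zero => rw [smul_zero]; exact zero_mem _
    | add x y _ _ hx hy => rw [smul_add]; exact add_mem hx hy
    | smul c x _ hx => rw [smul_algebra_smul_comm]; exact Submodule.smul_mem _ _ hx
  induction ha using Submodule.span_induction with
  | mem x hx =>
    obtain ⟨i, hij, rfl⟩ := hx
    cases i with
    | zero => rw [armPath, h.F_mul_E]; exact zero_mem _
    | succ i =>
      rw [h.armPath_mul_E]
      exact Submodule.subset_span ⟨_, by omega, hij, rfl⟩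
  | zero => rw [zero_mul]; exact zero_mem _
  | add x y _ _ hx hy => rw [add_mul]; exact add_mem hx hy
  | smul b x _ hx =>
    rw [smul_mul_assoc]
    refine h.smul_mem_of_stable ?_ (fun k => ?_) (fun k => ?_) b _ hx
    · exact hS (c := 1) fun i => by rw [h.F_mul_armPath, one_smul]
    · exact hS (c := 0) fun i => by rw [h.α_mul_armPath, zero_smul]
    · exact hS (c := 0) fun i => by rw [h.β_mul_armPath, zero_smul]

theorem nontrivial_armMod (h : TwoArmed K E F α β n n') (j : ℕ) :
    Nontrivial (ArmMod F α j) := by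
  refine Submodule.Quotient.nontrivial_iff.2 fun ht => h.E_ne ?_
  have := h.mul_E_mem_span (j := j) (a := 1) (by rw [ht]; trivial)
  rw [one_mul] at this
  have hE : ∀ x ∈ Submodule.span K {x | ∃ i, 1 ≤ i ∧ i ≤ j ∧ x = armPath F α i}, E * x = 0 := by
    intro x hx
    induction hx using Submodule.span_induction with
    | mem x hx =>
      obtain ⟨i, -, -, rfl⟩ := hx
      exact h.E_mul_armPath i
    | zero => exact mul_zero _
    | add x y _ _ hx hy => rw [mul_add, hx, hy, add_zero]
    | smul c x _ hx => rw [mul_smul_comm, hx, smul_zero]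
  rw [← h.E_mul_E, hE _ this]

theorem armPath_succ_smul_gen_ne (h : TwoArmed K E F α β n n') {j : ℕ} (hj : j < n) :
    armPath F α (j + 1) • ArmMod.gen F α j ≠ 0 := by
  rw [ArmMod.smul_gen, Ne, Submodule.Quotient.mk_eq_zero]
  intro hmem
  have := h.mul_E_mem_span hmem
  rw [h.armPath_mul_E] at this
  exact h.α_indep j hj this

theorem F_smul_gen (F : A) (α : ℕ → A) (j : ℕ) : F • ArmMod.gen F α j = 0 :=
  ArmMod.armPath_smul_gen (i := 0) (Nat.zero_le j)

theorem E_smul_gen (h : TwoArmed K E F α β n n') (j : ℕ) :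
    E • ArmMod.gen F α j = ArmMod.gen F α j := by
  rw [h.E_smul, F_smul_gen, sub_zero]

theorem span_gen (F : A) (α : ℕ → A) (j : ℕ) : Submodule.span A {ArmMod.gen F α j} = ⊤ := by
  refine eq_top_iff.2 fun x _ => ?_
  obtain ⟨a, rfl⟩ := ArmMod.exists_smul_gen x
  exact Submodule.smul_mem _ _ (Submodule.mem_span_singleton_self _)

theorem gen_ne_zero (h : TwoArmed K E F α β n n') (j : ℕ) : ArmMod.gen F α j ≠ 0 := by
  intro h0
  have := h.nontrivial_armMod j
  have ht := span_gen F α j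
  rw [h0, Submodule.span_zero_singleton] at ht
  exact bot_ne_top ht

theorem F_smul_armMod_eq_zero (h : TwoArmed K E F α β n n') (x : ArmMod F α n) :
    F • x = 0 := by
  have := (h.smul_of_span (span_gen F α n)
    (fun u hu => by rw [Set.mem_singleton_iff.1 hu, F_smul_gen]) x).1 0
  have hle : Submodule.span K {y | ∃ k, ∃ u ∈ ({ArmMod.gen F α n} : Set (ArmMod F α n)),
      y = armPath F α (k + 1) • u} ≤ ⊥ := by
    rw [Submodule.span_le]
    rintro _ ⟨k, u, hu, rfl⟩
    rw [Set.mem_singleton_iff.1 hu]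
    by_cases hk : k + 1 ≤ n
    · exact ArmMod.armPath_smul_gen hk
    · change _ = _
      rw [h.armPath_eq_zero _ (by omega), zero_smul]
  exact hle this

theorem exists_sub_smul_gen_mem (h : TwoArmed K E F α β n n') {j : ℕ} (x : ArmMod F α j) :
    ∃ c : K, x - c • ArmMod.gen F α j ∈ radSpan K α β (ArmMod F α j) := by
  have ht : Submodule.span K {ArmMod.gen F α j} ⊔ radSpan K α β (ArmMod F α j) = ⊤ := by
    refine h.eq_top_of_stable (span_gen F α j) ?_ (fun x hx => ?_)
      (fun k x _ => Submodule.mem_sup_right (α_smul_mem_radSpan k x))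
      (fun k x _ => Submodule.mem_sup_right (β_smul_mem_radSpan k x))
    · rw [Set.singleton_subset_iff]
      exact Submodule.mem_sup_left (Submodule.mem_span_singleton_self _)
    · obtain ⟨y, hy, z, hz, rfl⟩ := Submodule.mem_sup.1 hx
      obtain ⟨c, rfl⟩ := Submodule.mem_span_singleton.1 hy
      rw [smul_add, smul_algebra_smul_comm, F_smul_gen, smul_zero, zero_add]
      exact Submodule.mem_sup_right (h.F_smul_mem_radSpan _ hz)
  obtain ⟨y, hy, z, hz, rfl⟩ := Submodule.mem_sup.1 (ht ▸ Submodule.mem_top (x := x))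
  obtain ⟨c, rfl⟩ := Submodule.mem_span_singleton.1 hy
  exact ⟨c, by rwa [add_sub_cancel_left]⟩

theorem eq_top_of_notMem_radSpan (h : TwoArmed K E F α β n n') {j : ℕ}
    {N : Submodule A (ArmMod F α j)} {x : ArmMod F α j} (hxN : x ∈ N)
    (hx : x ∉ radSpan K α β (ArmMod F α j)) : N = ⊤ := by
  obtain ⟨c, hc⟩ := h.exists_sub_smul_gen_mem x
  have hc0 : c ≠ 0 := by
    rintro rfl
    rw [zero_smul, sub_zero] at hc
    exact hx hc
  refine h.eq_top_of_sup_radSpan N fun y => ?_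
  obtain ⟨d, hd⟩ := h.exists_sub_smul_gen_mem y
  refine ⟨(d * c⁻¹) • x, ?_, ?_⟩
  · rw [← algebraMap_smul A (d * c⁻¹)]
    exact N.smul_mem _ hxN
  · convert sub_mem hd (Submodule.smul_mem _ (d * c⁻¹) hc) using 1
    rw [smul_sub, smul_smul, inv_mul_cancel_right₀ hc0]
    abel

theorem exists_notMem_radSpan (h : TwoArmed K E F α β n n') {X : Type} [AddCommGroup X]
    [Module A X] [Module K X] [IsScalarTower K A X] [Nontrivial X] {U : Set X}
    (hU : Submodule.span A U = ⊤) : ∃ u ∈ U, u ∉ radSpan K α β X := by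
  by_contra! hc
  refine h.radSpan_ne_top (X := X) (eq_top_iff.2 fun x _ => ?_)
  have hx : x ∈ Submodule.span A U := by rw [hU]; trivial
  induction hx using Submodule.span_induction with
  | mem x hx => exact hc x hx
  | zero => exact zero_mem _
  | add x y _ _ hx hy => exact add_mem (hx trivial) (hy trivial)
  | smul a x _ hx => exact h.smul_mem_radSpan a x (hx trivial)

theorem isIndec_armMod (h : TwoArmed K E F α β n n') (j : ℕ) :
    IsIndec (ModuleCat.of A (ArmMod F α j)) := by
  have := h.nontrivial_armMod j
  refine ⟨this, fun (N N' : Submodule A (ArmMod F α j)) hNN' => ?_⟩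
  have key : ∀ N : Submodule A (ArmMod F α j), N = ⊤ ∨ ∀ x ∈ N, x ∈ radSpan K α β _ := by
    intro N
    by_contra! hc
    obtain ⟨hN, x, hxN, hx⟩ := hc
    exact hN (h.eq_top_of_notMem_radSpan hxN hx)
  rcases key N with rfl | hN
  · exact .inr (eq_bot_of_top_isCompl hNN')
  · rcases key N' with rfl | hN'
    · exact .inl (eq_bot_of_isCompl_top hNN')
    · refine absurd (eq_top_iff.2 fun x _ => ?_) (h.radSpan_ne_top (X := ArmMod F α j))
      obtain ⟨y, hy, z, hz, rfl⟩ :=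
        Submodule.mem_sup.1 (hNN'.sup_eq_top ▸ Submodule.mem_top (x := x))
      exact add_mem (hN y hy) (hN' z hz)

theorem gen_armMod_iff [IsNoetherianRing A] (h : TwoArmed K E F α β n n') {i j : ℕ}
    (hi : i ≤ n) :
    Gen A (ArmMod F α i) (ArmMod F α j) ↔ i ≤ j := by
  refine ⟨fun hg => ?_, ArmMod.gen_of_le⟩
  by_contra! hji
  have := h.nontrivial_armMod j
  obtain ⟨u, hu, hur⟩ := h.exists_notMem_radSpan
    ((ArmMod.gen_of_le (show j + 1 ≤ i by omega)).trans hg).span_armPath_eq_top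
  obtain ⟨f, hf⟩ := ArmMod.exists_lift u hu
  obtain ⟨π, hπ⟩ := ArmMod.exists_lift (F := F) (α := α) (j := j) (ArmMod.gen F α (j + 1))
    fun i hi => ArmMod.armPath_smul_gen (by omega)
  have hsurj : Function.Surjective (f ∘ₗ π) := by
    rw [← LinearMap.range_eq_top]
    refine h.eq_top_of_notMem_radSpan ⟨ArmMod.gen F α j, ?_⟩ hur
    rw [LinearMap.comp_apply, hπ, hf]
  refine h.armPath_succ_smul_gen_ne (show j < n by omega)
    (IsNoetherian.injective_of_surjective_endomorphism (f ∘ₗ π) hsurj ?_)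
  rw [map_zero, LinearMap.comp_apply, map_smul, hπ, ArmMod.armPath_smul_gen le_rfl, map_zero]

theorem not_gen_armMod_swap (h : TwoArmed K E F α β n n') (i j : ℕ) :
    ¬ Gen A (ArmMod E β i) (ArmMod F α j) := by
  intro hg
  have := h.nontrivial_armMod j
  obtain ⟨u, hu, hur⟩ := h.exists_notMem_radSpan hg.span_armPath_eq_top
  have hEu : E • u = 0 := hu 0 (Nat.zero_le i)
  obtain ⟨c, hc⟩ := h.exists_sub_smul_gen_mem u
  have := h.F_smul_mem_radSpan _ hc
  rw [smul_sub, smul_algebra_smul_comm, F_smul_gen, smul_zero, sub_zero, h.F_smul, hEu,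
    sub_zero] at this
  exact hur this

end TwoArmed

namespace TwoArmed

variable {K A : Type} [Field K] [Ring A] [Algebra K A] {E F : A} {α β : ℕ → A} {n n' : ℕ}

section Top

variable {X : Type} [AddCommGroup X] [Module A X] [Module K X] [IsScalarTower K A X]

theorem E_smul_mem_radSpan_of_coTop (h : TwoArmed K E F α β n n') (hX : coTop K F α β X = ⊤)
    (x : X) : E • x ∈ radSpan K α β X := by
  obtain ⟨r, hr, s, hs, rfl⟩ := Submodule.mem_sup.1 (hX ▸ Submodule.mem_top (x := x))
  have : E • s = 0 := by
    induction hs using Submodule.span_induction with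
    | mem s hs =>
      obtain ⟨m, rfl⟩ := hs
      rw [← mul_smul, h.E_mul_F, zero_smul]
    | zero => exact smul_zero _
    | add x y _ _ hx hy => rw [smul_add, hx, hy, add_zero]
    | smul c x _ hx => rw [smul_algebra_smul_comm, hx, smul_zero]
  rw [smul_add, this, add_zero]
  exact h.smul_mem_radSpan E r hr

theorem F_smul_mem_radSpan_of_coTop (h : TwoArmed K E F α β n n') (hX : coTop K E α β X = ⊤)
    (x : X) : F • x ∈ radSpan K α β X := by
  rw [radSpan_comm]
  exact h.swap.E_smul_mem_radSpan_of_coTop (by rwa [coTop_comm]) x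

theorem subsingleton_of_coTop (h : TwoArmed K E F α β n n') (hF : coTop K F α β X = ⊤)
    (hE : coTop K E α β X = ⊤) : Subsingleton X := by
  by_contra! hX
  refine h.radSpan_ne_top (X := X) (eq_top_iff.2 fun x _ => ?_)
  rw [← sub_add_cancel x (F • x), ← h.E_smul]
  exact add_mem (h.E_smul_mem_radSpan_of_coTop hF x) (h.F_smul_mem_radSpan_of_coTop hE x)

theorem span_F_smul_eq_zero (h : TwoArmed K E F α β n n') (hE : coTop K E α β X = ⊤) :
    Submodule.span A {x : X | F • x = 0} = ⊤ := by
  refine h.eq_top_of_sup_radSpan _ fun x => ⟨E • x, Submodule.subset_span ?_, ?_⟩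
  · change F • E • x = 0
    rw [← mul_smul, h.F_mul_E, zero_smul]
  · rw [← h.F_smul]
    exact h.F_smul_mem_radSpan_of_coTop hE x

end Top

/-- If every value `armPath F α i • x`, `i ≤ j`, is a combination of values of longer paths, then
`X` is generated by elements annihilated by `armPath F α i`, `i ≤ j`. -/
theorem gen_of_armPath_smul_mem [IsNoetherianRing A] (h : TwoArmed K E F α β n n') {X : Type}
    [AddCommGroup X] [Module A X] [Module K X] [IsScalarTower K A X] [Module.Finite A X] {j : ℕ}
    (hX : ∀ i ≤ j, ∀ x : X, armPath F α i • x ∈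
      Submodule.span K {y | ∃ k, ∃ m : X, j < k ∧ y = armPath F α k • m}) :
    Gen A (ArmMod F α j) X := by
  have key : ∀ i ≤ j, ∀ z ∈ Submodule.span K {y | ∃ k, ∃ m : X, j < k ∧ y = armPath F α k • m},
      ∃ y ∈ radSpan K α β X, armPath F α i • y = z ∧
        ∀ l, l ≠ i → armPath F α l • y = 0 := by
    intro i hi z hz
    induction hz using Submodule.span_induction with
    | mem z hz =>
      obtain ⟨k, m, hk, rfl⟩ := hz
      obtain ⟨d, rfl⟩ := Nat.exists_eq_add_of_lt (show i < k by omega)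
      refine ⟨armSeg α i (d + 1) • m, ?_, ?_, fun l hl => ?_⟩
      · rw [armSeg, mul_smul]
        exact α_smul_mem_radSpan _ _
      · rw [← mul_smul, armPath_mul_armSeg, add_assoc]
      · rw [← mul_smul, h.armPath_mul_armSeg_of_ne hl, zero_smul]
    | zero => exact ⟨0, zero_mem _, smul_zero _, fun _ _ => smul_zero _⟩
    | add z w _ _ hz hw =>
      obtain ⟨x, hxr, hx, hx'⟩ := hz
      obtain ⟨y, hyr, hy, hy'⟩ := hw
      exact ⟨x + y, add_mem hxr hyr, by rw [smul_add, hx, hy],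
        fun i hi => by rw [smul_add, hx' i hi, hy' i hi, add_zero]⟩
    | smul c z _ hz =>
      obtain ⟨x, hxr, hx, hx'⟩ := hz
      exact ⟨c • x, Submodule.smul_mem _ _ hxr, by rw [smul_algebra_smul_comm, hx],
        fun i hi => by rw [smul_algebra_smul_comm, hx' i hi, smul_zero]⟩
  refine .of_span_armPath (h.eq_top_of_sup_radSpan _ fun x => ?_)
  choose y hyr hy hy' using fun i : Fin (j + 1) =>
    key i (Nat.lt_succ_iff.1 i.2) _ (hX i (Nat.lt_succ_iff.1 i.2) x)
  refine ⟨x - ∑ i, y i, Submodule.subset_span fun i hi => ?_, ?_⟩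
  · rw [smul_sub, Finset.smul_sum, sub_eq_zero,
      Finset.sum_eq_single ⟨i, by omega⟩ (fun l _ hl => hy' l i
        fun hil => hl (Fin.ext hil.symm)) (by simp)]
    exact (hy ⟨i, by omega⟩).symm
  · rw [sub_sub_cancel]
    exact sum_mem fun i _ => hyr i

section Hom

variable {X Q : Type} [AddCommGroup X] [Module A X] [Module K X] [IsScalarTower K A X]
  [AddCommGroup Q] [Module A Q] [Module K Q] [IsScalarTower K A Q]

/-- A nonzero homomorphism built from a functional vanishing on the values of the paths of length
greater than `j + 1`. -/
theorem exists_hom_ne_zero_of_functional (h : TwoArmed K E F α β n n')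
    (hX : Submodule.span A {x : X | F • x = 0} = ⊤) {j : ℕ} (φ : X →ₗ[K] K)
    (hφ : ∀ m, φ (armPath F α (j + 2) • m) = 0) {i₀ : ℕ} (hi₀ : i₀ ≤ j + 1) {m₀ : X}
    (hm₀ : φ (armPath F α i₀ • m₀) ≠ 0) {v : Q} (hFv : F • v = 0)
    (hαv : ∀ k, k ≠ j → α k • v = 0) (hpv : ∀ i ≤ j, armPath F α i • v = 0)
    (hv : armPath F α (j + 1) • v ≠ 0) : ∃ f : X →ₗ[A] Q, f ≠ 0 := by
  have hβX : ∀ k (x : X), β k • x = 0 := fun k x => (h.smul_of_span hX (fun u hu => hu) x).2 k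
  let w : ℕ → Q := fun i => armSeg α i (j + 1 - i) • v
  have hw_last : w (j + 1) = v := by simp [w, armSeg]
  have hw : ∀ i ≤ j, w i = α i • w (i + 1) := by
    intro i hi
    simp only [w]
    rw [← mul_smul, show j + 1 - i = (j + 1 - (i + 1)) + 1 by omega, armSeg]
  have hαw : ∀ k i, i ≤ j + 1 → α k • w i = if i = k + 1 then w k else 0 := by
    intro k i hi
    split_ifs with hik
    · rw [hw k (by omega), hik]
    · rcases hi.lt_or_eq with hi | rfl
      · rw [hw i (by omega), ← mul_smul, h.α_mul_α k i hik, zero_smul]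
      · rw [hw_last, hαv k (by omega)]
  have hFw : ∀ i ≤ j + 1, F • w i = if i = 0 then w 0 else 0 := by
    intro i hi
    split_ifs with hi0
    · rw [hi0, hw 0 (by omega), ← mul_smul, h.F_mul_α_zero]
    · rcases hi.lt_or_eq with hi | rfl
      · obtain ⟨i, rfl⟩ := Nat.exists_eq_succ_of_ne_zero hi0
        rw [hw _ (by omega), ← mul_smul, h.F_mul_α_succ, zero_smul]
      · rw [hw_last, hFv]
  have hβw : ∀ k i, i ≤ j + 1 → β k • w i = 0 := by
    intro k i hi
    rcases hi.lt_or_eq with hi | rfl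
    · rw [hw i (by omega), ← mul_smul, h.β_mul_α, zero_smul]
    · rw [hw_last, h.β_smul_eq_zero hFv]
  have hpw : ∀ l ≤ j + 1, ∀ i ≤ j + 1, armPath F α l • w i =
      if i = l then armPath F α (j + 1) • v else 0 := by
    intro l hl i hi
    split_ifs with hil
    · subst hil
      rw [← mul_smul, armPath_mul_armSeg, Nat.add_sub_cancel' hi]
    · rcases hi.lt_or_eq with hi | rfl
      · rw [hw i (by omega), ← mul_smul, h.armPath_mul_α, if_neg (Ne.symm hil), zero_smul]
      · rw [hw_last, hpv l (by omega)]
  let f : X →ₗ[K] Q := ∑ i ∈ Finset.range (j + 2),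
    (φ ∘ₗ Algebra.lsmul K K X (armPath F α i)).smulRight (w i)
  have hf : ∀ x, f x = ∑ i ∈ Finset.range (j + 2), φ (armPath F α i • x) • w i := fun x => by
    simp [f]
  have hsmul : ∀ (a : A) x,
      a • f x = ∑ i ∈ Finset.range (j + 2), φ (armPath F α i • x) • a • w i := fun a x => by
    rw [hf, Finset.smul_sum]
    exact Finset.sum_congr rfl fun i _ => smul_algebra_smul_comm _ _ _
  obtain ⟨g, hg⟩ := h.exists_linearMap f
    (fun x => by
      rw [hsmul, hf]
      refine Finset.sum_congr rfl fun i hi => ?_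
      rw [hFw i (by simp at hi; omega), ← mul_smul]
      cases i with
      | zero => rw [armPath, h.F_mul_F, if_pos rfl]
      | succ i => rw [h.armPath_mul_F, zero_smul, map_zero, zero_smul, if_neg (by omega),
          smul_zero])
    (fun k x => by
      rw [hsmul, hf]
      have h1 : ∀ i ∈ Finset.range (j + 2), φ (armPath F α i • α k • x) • w i =
          if i = k then φ (armPath F α (k + 1) • x) • w k else 0 := fun i _ => by
        rw [← mul_smul, h.armPath_mul_α]
        split_ifs with hik
        · rw [hik]
        · rw [zero_smul, map_zero, zero_smul]
      have h2 : ∀ i ∈ Finset.range (j + 2), φ (armPath F α i • x) • α k • w i =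
          if i = k + 1 then φ (armPath F α (k + 1) • x) • w k else 0 := fun i hi => by
        rw [hαw k i (by simp at hi; omega)]
        split_ifs with hik
        · rw [hik]
        · rw [smul_zero]
      rw [Finset.sum_congr rfl h1, Finset.sum_congr rfl h2, Finset.sum_ite_eq', Finset.sum_ite_eq']
      rcases eq_or_ne k (j + 1) with rfl | hk
      · rw [hφ, zero_smul, ite_self, ite_self]
      · simp only [Finset.mem_range, show k < j + 2 ↔ k + 1 < j + 2 by omega])
    (fun k x => by
      rw [hsmul, hβX, map_zero]
      refine (Finset.sum_eq_zero fun i hi => ?_).symm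
      rw [hβw k i (by simp at hi; omega), smul_zero])
  refine ⟨g, fun hg0 => ?_⟩
  have h0 : armPath F α i₀ • f m₀ = 0 := by rw [← hg, hg0, LinearMap.zero_apply, smul_zero]
  rw [hsmul, Finset.sum_eq_single i₀, hpw i₀ hi₀ i₀ hi₀, if_pos rfl] at h0
  · exact smul_ne_zero hm₀ hv h0
  · intro i hi hii
    rw [hpw i₀ hi₀ i (by simp at hi; omega), if_neg hii, smul_zero]
  · intro hi
    simp at hi
    omega

end Hom

section Classification

variable [IsNoetherianRing A] {M : Mdl A} [Module K M] [IsScalarTower K A M]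

theorem gen_armMod_succ_of_not_gen (h : TwoArmed K E F α β n n') (hM : IsTauRigid M)
    (hspan : Submodule.span A {x : M | F • x = 0} = ⊤) {j : ℕ}
    (hj : Gen A M (ArmMod F α (j + 1))) (hj' : ¬ Gen A M (ArmMod F α j)) :
    Gen A (ArmMod F α (j + 1)) M := by
  have := hM.1
  obtain ⟨t, hnt, ht⟩ := hM.exists_torsionFree_quotient _ hj'
  have hzero : ∀ x : ArmMod F α j ⧸ t, (∀ i ≤ j + 1, armPath F α i • x = 0) → x = 0 := by
    intro x hx
    obtain ⟨f, rfl⟩ := ArmMod.exists_lift x hx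
    rw [hj.hom_eq_zero ht f, LinearMap.zero_apply]
  let g : ArmMod F α j ⧸ t := Submodule.Quotient.mk (ArmMod.gen F α j)
  have hpg : ∀ i ≤ j, armPath F α i • g = 0 := fun i hi => by
    rw [← Submodule.Quotient.mk_smul, ArmMod.armPath_smul_gen hi, Submodule.Quotient.mk_zero]
  have hg : g ≠ 0 := by
    intro hg0
    obtain ⟨y, hy⟩ := exists_ne (0 : ArmMod F α j ⧸ t)
    obtain ⟨x, rfl⟩ := Submodule.Quotient.mk_surjective _ y
    obtain ⟨a, rfl⟩ := ArmMod.exists_smul_gen x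
    exact hy (by rw [Submodule.Quotient.mk_smul]; exact (congrArg (a • ·) hg0).trans (smul_zero a))
  obtain ⟨v, hFv, hαv, hpv, hv⟩ : ∃ v : ArmMod F α j ⧸ t, F • v = 0 ∧
      (∀ k, k ≠ j → α k • v = 0) ∧ (∀ i ≤ j, armPath F α i • v = 0) ∧
      armPath F α (j + 1) • v ≠ 0 := by
    have hne : ∀ v : ArmMod F α j ⧸ t, v ≠ 0 → (∀ i ≤ j, armPath F α i • v = 0) →
        armPath F α (j + 1) • v ≠ 0 := fun v hv hpv h0 => hv (hzero v fun i hi => by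
      rcases hi.lt_or_eq with hi | rfl
      · exact hpv i (by omega)
      · exact h0)
    by_cases hα : α (j + 1) • g = 0
    · refine ⟨g, hpg 0 (Nat.zero_le j), fun k hk => ?_, hpg, hne g hg hpg⟩
      rcases eq_or_ne k (j + 1) with rfl | hk'
      · exact hα
      · refine hzero _ fun i hi => ?_
        rw [← mul_smul, h.armPath_mul_α]
        split_ifs with hik
        · exact hpg _ (by omega)
        · exact zero_smul _ _
    · have hpv : ∀ i ≤ j, armPath F α i • α (j + 1) • g = 0 := fun i hi => by
        rw [← mul_smul, h.armPath_mul_α, if_neg (by omega), zero_smul]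
      refine ⟨_, ?_, fun k hk => ?_, hpv, hne _ hα hpv⟩
      · rw [← mul_smul, h.F_mul_α_succ, zero_smul]
      · rw [← mul_smul, h.α_mul_α _ _ (by omega), zero_smul]
  refine h.gen_of_armPath_smul_mem fun i₀ hi₀ m₀ => ?_
  by_contra hm₀
  obtain ⟨φ, hφm, hφ⟩ := Submodule.exists_le_ker_of_notMem hm₀
  obtain ⟨f, hf⟩ := h.exists_hom_ne_zero_of_functional hspan φ
    (fun m => hφ (Submodule.subset_span ⟨j + 2, m, by omega, rfl⟩)) hi₀ hφm hFv hαv hpv hv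
  exact hf (ht f)

theorem gen_of_coTop_ne_top (h : TwoArmed K E F α β n n') (hM : IsTauRigid M)
    (hF : coTop K F α β M ≠ ⊤) {X : Type} [AddCommGroup X] [Module A X] [Module K X]
    [IsScalarTower K A X] [Module.Finite A X]
    (hX : coTop K E α β M ≠ ⊤ ∨ ∀ x : X, F • x = 0) : Gen A M X := by
  by_contra hXM
  obtain ⟨t, hnt, ht⟩ := hM.exists_torsionFree_quotient _ hXM
  obtain ⟨y, hy, hα, hβ, hEF⟩ := h.exists_socle (X := X ⧸ t)
  by_cases hFy : F • y = 0
  · obtain ⟨f, hf⟩ := h.exists_hom_ne_zero hF hy hα hβ hFy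
    exact hf (ht f)
  · rcases hX with hE | hX
    · rw [coTop_comm] at hE
      obtain ⟨f, hf⟩ := h.swap.exists_hom_ne_zero hE hy hβ hα (hEF.resolve_left hFy)
      exact hf (ht f)
    · obtain ⟨x, rfl⟩ := Submodule.Quotient.mk_surjective _ y
      exact hFy (by rw [← Submodule.Quotient.mk_smul, hX, Submodule.Quotient.mk_zero])

theorem exists_gen_armMod (h : TwoArmed K E F α β n n') (hM : IsTauRigid M)
    (hF : coTop K F α β M ≠ ⊤) (hE : coTop K E α β M = ⊤) :
    ∃ j ≤ n, Gen A M (ArmMod F α j) ∧ Gen A (ArmMod F α j) M := by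
  classical
  have := hM.1
  have hspan := h.span_F_smul_eq_zero hE
  have hn : Gen A M (ArmMod F α n) :=
    h.gen_of_coTop_ne_top hM hF (.inr h.F_smul_armMod_eq_zero)
  have hex : ∃ j, Gen A M (ArmMod F α j) := ⟨n, hn⟩
  refine ⟨Nat.find hex, Nat.find_min' hex hn, Nat.find_spec hex, ?_⟩
  rcases hj : Nat.find hex with _ | j
  · refine .of_span_armPath (top_unique (hspan.ge.trans (Submodule.span_mono fun x hx i hi => ?_)))
    rw [Nat.le_zero.1 hi]
    exact hx
  · exact h.gen_armMod_succ_of_not_gen hM hspan (hj ▸ Nat.find_spec hex)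
      (Nat.find_min hex (by omega))

end Classification

theorem gen_armMod_prod [IsNoetherianRing A] (h : TwoArmed K E F α β n n') (X : Type)
    [AddCommGroup X] [Module A X] [Module.Finite A X] :
    Gen A (ArmMod F α 0 × ArmMod E β 0) X := by
  refine .of_span (U := {x | F • x = 0 ∨ E • x = 0}) (eq_top_iff.2 fun x _ => ?_) ?_
  · rw [← sub_add_cancel x (F • x), ← h.E_smul]
    refine add_mem (Submodule.subset_span (.inl ?_)) (Submodule.subset_span (.inr ?_))
    · rw [← mul_smul, h.F_mul_E, zero_smul]
    · rw [← mul_smul, h.E_mul_F, zero_smul]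
  · rintro u (hu | hu)
    · obtain ⟨f, hf⟩ := ArmMod.exists_lift (F := F) (α := α) (j := 0) u fun i hi => by
        rw [Nat.le_zero.1 hi]; exact hu
      exact ⟨f ∘ₗ LinearMap.fst A _ _, (ArmMod.gen F α 0, 0), hf⟩
    · obtain ⟨f, hf⟩ := ArmMod.exists_lift (F := E) (α := β) (j := 0) u fun i hi => by
        rw [Nat.le_zero.1 hi]; exact hu
      exact ⟨f ∘ₗ LinearMap.snd A _ _, (0, ArmMod.gen E β 0), hf⟩

end TwoArmed

/-- The idempotents and the nonzero paths in the arrows of a `TwoArmedRel` algebra. -/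
def pathFamily {A : Type} [Ring A] (E F : A) (α β : ℕ → A) (n n' : ℕ) :
    Bool ⊕ (Σ k : Fin n, Fin (k + 1)) ⊕ (Σ k : Fin n', Fin (k + 1)) → A
  | .inl b => if b then E else F
  | .inr (.inl p) => armSeg α p.2 (p.1 - p.2 + 1)
  | .inr (.inr p) => armSeg β p.2 (p.1 - p.2 + 1)

theorem card_sigma_fin (n : ℕ) : Fintype.card (Σ k : Fin n, Fin (k + 1)) = (n + 1) * n / 2 := by
  rw [Fintype.card_sigma]
  simp only [Fintype.card_fin]
  rw [Fin.sum_univ_eq_sum_range (fun k => k + 1)]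
  have := Finset.sum_range_id (n + 1)
  rwa [Finset.sum_range_succ', add_zero] at this

namespace TwoArmedRel

variable {K A : Type} [Field K] [Ring A] [Algebra K A] {E F : A} {α β : ℕ → A} {n n' : ℕ}

theorem armSeg_eq_zero (h : TwoArmedRel K E F α β n n') {m d : ℕ} (hmd : n ≤ m + d) :
    armSeg α m (d + 1) = 0 := by
  induction d generalizing m with
  | zero => rw [armSeg, h.α_eq_zero m hmd, zero_mul]
  | succ d ih => rw [armSeg, ih (by omega), mul_zero]

theorem armSeg_mem_span (h : TwoArmedRel K E F α β n n') (m d : ℕ) :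
    armSeg α m (d + 1) ∈ Submodule.span K (Set.range (pathFamily E F α β n n')) := by
  by_cases hmd : n ≤ m + d
  · rw [h.armSeg_eq_zero hmd]
    exact zero_mem _
  · refine Submodule.subset_span ⟨.inr (.inl ⟨⟨m + d, by omega⟩, ⟨m, ?_⟩⟩), ?_⟩
    · change m < m + d + 1
      omega
    · change armSeg α m (m + d - m + 1) = _
      rw [Nat.add_sub_cancel_left]

theorem range_pathFamily_swap (E F : A) (α β : ℕ → A) (n n' : ℕ) :
    Set.range (pathFamily E F α β n n') ⊆ Set.range (pathFamily F E β α n' n) := by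
  rintro _ ⟨b | p | p, rfl⟩
  · exact ⟨.inl !b, by cases b <;> rfl⟩
  · exact ⟨.inr (.inr p), rfl⟩
  · exact ⟨.inr (.inl p), rfl⟩

theorem α_smul_mem_span (h : TwoArmedRel K E F α β n n') (k : ℕ) (x : A)
    (hx : x ∈ Submodule.span K (Set.range (pathFamily E F α β n n'))) :
    α k • x ∈ Submodule.span K (Set.range (pathFamily E F α β n n')) := by
  induction hx using Submodule.span_induction with
  | mem x hx =>
    obtain ⟨b | p | p, rfl⟩ := hx
    · cases b
      · change α k * F ∈ _
        rw [h.α_mul_F]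
        exact zero_mem _
      · change α k * E ∈ _
        rw [h.α_mul_E]
        have := h.armSeg_mem_span k 0
        rwa [armSeg, armSeg, mul_one] at this
    · change α k * armSeg α p.2 (p.1 - p.2 + 1) ∈ _
      by_cases hk : (p.2 : ℕ) = k + 1
      · have := h.armSeg_mem_span k (p.1 - p.2 + 1)
        rwa [armSeg, ← hk] at this
      · rw [armSeg, ← mul_assoc, h.α_mul_α _ _ hk, zero_mul]
        exact zero_mem _
    · change α k * armSeg β p.2 (p.1 - p.2 + 1) ∈ _
      rw [armSeg, ← mul_assoc, h.α_mul_β, zero_mul]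
      exact zero_mem _
  | zero => rw [smul_zero]; exact zero_mem _
  | add x y _ _ hx hy => rw [smul_add]; exact add_mem hx hy
  | smul c x _ hx => rw [smul_algebra_smul_comm]; exact Submodule.smul_mem _ _ hx

theorem F_smul_mem_span (h : TwoArmedRel K E F α β n n') (x : A)
    (hx : x ∈ Submodule.span K (Set.range (pathFamily E F α β n n'))) :
    F • x ∈ Submodule.span K (Set.range (pathFamily E F α β n n')) := by
  have key : F * α 0 = α 0 ∧ (∀ k, F * α (k + 1) = 0) ∧ F * β 0 = 0 ∧
      ∀ k, F * β (k + 1) = β (k + 1) :=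
    ⟨h.F_mul_α_zero, h.F_mul_α_succ, h.swap.E_mul_α_zero, h.swap.E_mul_α_succ⟩
  have hseg : ∀ γ : ℕ → A, (∀ k, F * γ k = 0 ∨ F * γ k = γ k) → ∀ m d,
      F * armSeg γ m (d + 1) = 0 ∨ F * armSeg γ m (d + 1) = armSeg γ m (d + 1) := by
    intro γ hγ m d
    rw [armSeg, ← mul_assoc]
    rcases hγ m with h0 | h1
    · rw [h0, zero_mul]
      exact .inl rfl
    · rw [h1]
      exact .inr rfl
  induction hx using Submodule.span_induction with
  | mem x hx =>
    suffices F * x = 0 ∨ F * x = x by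
      rw [smul_eq_mul]
      rcases this with h0 | h1
      · rw [h0]
        exact zero_mem _
      · rw [h1]
        exact Submodule.subset_span hx
    obtain ⟨b | p | p, rfl⟩ := hx
    · cases b
      · exact .inr h.F_mul_F
      · exact .inl h.F_mul_E
    · refine hseg α (fun k => ?_) _ _
      cases k
      · exact .inr key.1
      · exact .inl (key.2.1 _)
    · refine hseg β (fun k => ?_) _ _
      cases k
      · exact .inl key.2.2.1
      · exact .inr (key.2.2.2 _)
  | zero => rw [smul_zero]; exact zero_mem _
  | add x y _ _ hx hy => rw [smul_add]; exact add_mem hx hy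
  | smul c x _ hx => rw [smul_algebra_smul_comm]; exact Submodule.smul_mem _ _ hx

theorem span_pathFamily (h : TwoArmedRel K E F α β n n') :
    Submodule.span K (Set.range (pathFamily E F α β n n')) = ⊤ := by
  refine h.eq_top_of_stable (U := {E, F}) (eq_top_iff.2 fun x _ => ?_) ?_ h.F_smul_mem_span
    h.α_smul_mem_span fun k x hx => ?_
  · rw [← mul_one x, ← h.E_add_F, ← smul_eq_mul]
    exact Submodule.smul_mem _ _
      (add_mem (Submodule.subset_span (.inl rfl)) (Submodule.subset_span (.inr rfl)))
  · rintro _ (rfl | rfl)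
    · exact Submodule.subset_span ⟨.inl true, rfl⟩
    · exact Submodule.subset_span ⟨.inl false, rfl⟩
  · refine Submodule.span_mono (range_pathFamily_swap F E β α n' n) ?_
    exact h.swap.α_smul_mem_span k x (Submodule.span_mono (range_pathFamily_swap E F α β n n') hx)

theorem armPath_succ (h : TwoArmedRel K E F α β n n') (i : ℕ) :
    armPath F α (i + 1) = armSeg α 0 (i + 1) := by
  have := armPath_mul_armSeg F α 0 (i + 1)
  rw [zero_add] at this
  rw [← this, armPath, armSeg, ← mul_assoc, h.F_mul_α_zero]

theorem armPath_notMem_span (h : TwoArmedRel K E F α β n n')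
    (hdim : Module.finrank K A = 2 + (n + 1) * n / 2 + (n' + 1) * n' / 2) {j : ℕ} (hj : j < n) :
    armPath F α (j + 1) ∉ Submodule.span K {x | ∃ i, 1 ≤ i ∧ i ≤ j ∧ x = armPath F α i} := by
  have hli : LinearIndependent K (pathFamily E F α β n n') := by
    refine linearIndependent_of_top_le_span_of_card_eq_finrank h.span_pathFamily.ge ?_
    rw [Fintype.card_sum, Fintype.card_sum, card_sigma_fin, card_sigma_fin, Fintype.card_bool,
      hdim, add_assoc]
  let p : Fin n → Bool ⊕ (Σ k : Fin n, Fin (k + 1)) ⊕ (Σ k : Fin n', Fin (k + 1)) :=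
    fun i => .inr (.inl ⟨i, 0⟩)
  have hp : ∀ i, pathFamily E F α β n n' (p i) = armPath F α (i + 1) := fun i => by
    rw [h.armPath_succ]
    rfl
  have hmem := hli.notMem_span_image (x := p ⟨j, hj⟩) (s := p '' {i | i.1 < j}) (by
    rintro ⟨i, hi, hij⟩
    have : i = ⟨j, hj⟩ := congrArg Sigma.fst (Sum.inl_injective (Sum.inr_injective hij))
    rw [this] at hi
    exact lt_irrefl j hi)
  rw [hp] at hmem
  refine fun hm => hmem (Submodule.span_mono ?_ hm)
  rintro _ ⟨i, hi, hij, rfl⟩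
  obtain ⟨i, rfl⟩ := Nat.exists_eq_add_of_le' hi
  exact ⟨p ⟨i, by omega⟩, ⟨_, hij, rfl⟩, hp _⟩

theorem twoArmed (h : TwoArmedRel K E F α β n n')
    (hdim : Module.finrank K A = 2 + (n + 1) * n / 2 + (n' + 1) * n' / 2) :
    TwoArmed K E F α β n n' where
  toTwoArmedRel := h
  α_indep _ hj := h.armPath_notMem_span hdim hj
  β_indep _ hj := h.swap.armPath_notMem_span (by rw [hdim, add_right_comm]) hj

end TwoArmedRel

section Tilt

variable {A : Type} [Ring A]

theorem facLE_iff {M N : Mdl A} : FacLE M N ↔ Gen A N M :=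
  ⟨fun h => h M Gen.refl, fun h _ hX => h.trans hX⟩

/-- The `j`-th module of the chain of support `τ`-tilting modules attached to `α`. -/
noncomputable def armTilt (F : A) (α : ℕ → A) (n j : ℕ) : Mdl A :=
  if j < n then dsum (ModuleCat.of A (ArmMod F α j)) (ModuleCat.of A (ArmMod F α (j + 1)))
  else ModuleCat.of A (ArmMod F α n)

theorem armTilt_of_lt {F : A} {α : ℕ → A} {n j : ℕ} (hj : j < n) : armTilt F α n j =
    dsum (ModuleCat.of A (ArmMod F α j)) (ModuleCat.of A (ArmMod F α (j + 1))) :=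
  if_pos hj

theorem armTilt_self {F : A} {α : ℕ → A} {n : ℕ} :
    armTilt F α n n = ModuleCat.of A (ArmMod F α n) :=
  if_neg (lt_irrefl n)

theorem gen_armMod_armTilt (F : A) (α : ℕ → A) {n j : ℕ} (hj : j ≤ n) :
    Gen A (ArmMod F α j) (armTilt F α n j) := by
  rcases hj.lt_or_eq with hj | rfl
  · rw [armTilt_of_lt hj]
    exact Gen.refl.of_prod (ArmMod.gen_of_le (Nat.le_succ j))
  · rw [armTilt_self]
    exact Gen.refl

theorem gen_armTilt_armMod (F : A) (α : ℕ → A) {n j : ℕ} (hj : j ≤ n) :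
    Gen A (armTilt F α n j) (ArmMod F α j) := by
  rcases hj.lt_or_eq with hj | rfl
  · rw [armTilt_of_lt hj]
    exact .of_surjective (LinearMap.fst A (ArmMod F α j) (ArmMod F α (j + 1)))
      LinearMap.fst_surjective
  · rw [armTilt_self]
    exact Gen.refl

/-- The family of all support `τ`-tilting modules of a `TwoArmed` algebra. -/
noncomputable def tiltMod (E F : A) (α β : ℕ → A) (n n' : ℕ) :
    Fin (n + 1 + 2) ⊕ Fin (n' + 1) → Mdl A
  | .inl k =>
    if k.1 = 0 then dsum (ModuleCat.of A (ArmMod F α 0)) (ModuleCat.of A (ArmMod E β 0))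
    else if k.1 ≤ n + 1 then armTilt F α n (k.1 - 1) else ModuleCat.of A PUnit
  | .inr k => armTilt E β n' k

variable {E F : A} {α β : ℕ → A} {n n' : ℕ}

theorem tiltMod_zero : tiltMod E F α β n n' (.inl 0) =
    dsum (ModuleCat.of A (ArmMod F α 0)) (ModuleCat.of A (ArmMod E β 0)) := by
  simp [tiltMod]

theorem tiltMod_succ {j : ℕ} (hj : j ≤ n) :
    tiltMod E F α β n n' (.inl ⟨j + 1, by omega⟩) = armTilt F α n j := by
  simp [tiltMod, hj]

theorem tiltMod_last :
    tiltMod E F α β n n' (.inl (Fin.last (n + 2))) = ModuleCat.of A PUnit := by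
  simp [tiltMod]

theorem tiltMod_inr (k : Fin (n' + 1)) :
    tiltMod E F α β n n' (.inr k) = armTilt E β n' k := rfl

/-- Case analysis on the indices of the long chain of `tiltMod`. -/
theorem fin_chain_cases {n : ℕ} {p : Fin (n + 1 + 2) → Prop} (zero : p 0)
    (succ : ∀ j (hj : j ≤ n), p ⟨j + 1, by omega⟩) (last : p (Fin.last (n + 2))) (k) : p k := by
  obtain ⟨_ | j, hk⟩ := k
  · exact zero
  · rcases (show j ≤ n + 1 by omega).lt_or_eq with hj | rfl
    · exact succ j (by omega)
    · exact last

theorem Gen.nontrivial {M X : Type} [AddCommGroup M] [Module A M] [AddCommGroup X] [Module A X]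
    (h : Gen A M X) [Nontrivial X] : Nontrivial M := by
  by_contra! hM
  obtain ⟨n, f, hf⟩ := h
  exact not_subsingleton X hf.subsingleton

end Tilt

namespace TwoArmed

variable {K A : Type} [Field K] [Ring A] [Algebra K A] {E F : A} {α β : ℕ → A} {n n' : ℕ}

theorem gen_armTilt_iff [IsNoetherianRing A] (h : TwoArmed K E F α β n n') {i j : ℕ} (hi : i ≤ n)
    (hj : j ≤ n) : Gen A (armTilt F α n i) (armTilt F α n j) ↔ i ≤ j := by
  rw [← h.gen_armMod_iff hi]
  exact ⟨fun hg => (gen_armMod_armTilt F α hi).trans (hg.trans (gen_armTilt_armMod F α hj)),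
    fun hg => (gen_armTilt_armMod F α hi).trans (hg.trans (gen_armMod_armTilt F α hj))⟩

theorem not_gen_armTilt_armMod_swap (h : TwoArmed K E F α β n n') {i : ℕ} (hi : i ≤ n') (j : ℕ) :
    ¬ Gen A (armTilt E β n' i) (ArmMod F α j) := fun hg =>
  h.not_gen_armMod_swap i j ((gen_armMod_armTilt E β hi).trans hg)

theorem not_gen_armTilt_swap (h : TwoArmed K E F α β n n') {i j : ℕ} (hi : i ≤ n') (hj : j ≤ n) :
    ¬ Gen A (armTilt E β n' i) (armTilt F α n j) := fun hg =>
  h.not_gen_armTilt_armMod_swap hi j (hg.trans (gen_armTilt_armMod F α hj))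

theorem not_gen_punit_armTilt (h : TwoArmed K E F α β n n') {j : ℕ} (hj : j ≤ n) :
    ¬ Gen A PUnit (armTilt F α n j) := fun hg =>
  have := h.nontrivial_armMod j
  not_nontrivial PUnit (hg.trans (gen_armTilt_armMod F α hj)).nontrivial

theorem finite_tiltMod (E F : A) (α β : ℕ → A) (n n' : ℕ) (b) :
    Module.Finite A (tiltMod E F α β n n' b) := by
  rcases b with k | k
  · induction k using fin_chain_cases with
    | zero => rw [tiltMod_zero]; exact Module.Finite.prod
    | succ j hj => rw [tiltMod_succ hj]; exact (gen_armMod_armTilt F α hj).finite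
    | last => rw [tiltMod_last]; exact Module.Finite.of_finite
  · exact (gen_armMod_armTilt E β (Nat.lt_succ_iff.1 k.2)).finite

theorem facLE_tiltMod_iff [IsNoetherianRing A] (h : TwoArmed K E F α β n n') (b c) :
    FacLE (tiltMod E F α β n n' b) (tiltMod E F α β n n' c) ↔ Ple (n + 1) (n' + 1) b c := by
  rw [facLE_iff]
  have hfst : Gen A (ArmMod F α 0 × ArmMod E β 0) (ArmMod F α 0) :=
    .of_surjective (LinearMap.fst A _ _) LinearMap.fst_surjective
  have hsnd : Gen A (ArmMod F α 0 × ArmMod E β 0) (ArmMod E β 0) :=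
    .of_surjective (LinearMap.snd A _ _) LinearMap.snd_surjective
  have hzero : ∀ b, Gen A (tiltMod E F α β n n' (.inl 0)) (tiltMod E F α β n n' b) := fun b => by
    have := finite_tiltMod E F α β n n' b
    rw [tiltMod_zero]
    exact h.gen_armMod_prod _
  have hlast : ∀ c, Gen A (tiltMod E F α β n n' c)
      (tiltMod E F α β n n' (.inl (Fin.last (n + 2)))) := fun c => by
    rw [tiltMod_last]
    exact .of_subsingleton
  have hlast' : ∀ X : Mdl A, Nontrivial X →
      ¬ Gen A (tiltMod E F α β n n' (.inl (Fin.last (n + 2)))) X := fun X hX hg => by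
    rw [tiltMod_last] at hg
    exact not_nontrivial PUnit hg.nontrivial
  rcases b with b | b <;> rcases c with c | c
  · change _ ↔ c ≤ b
    induction c using fin_chain_cases with
    | zero => exact iff_of_true (hzero _) (Fin.zero_le b)
    | succ i hi =>
      induction b using fin_chain_cases with
      | zero =>
        rw [tiltMod_succ hi, tiltMod_zero]
        refine iff_of_false (fun hg => ?_) (by simp)
        exact h.swap.not_gen_armTilt_armMod_swap hi 0 (hg.trans hsnd)
      | succ j hj =>
        rw [tiltMod_succ hi, tiltMod_succ hj, h.gen_armTilt_iff hi hj]
        simp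
      | last => exact iff_of_true (hlast _) (Fin.le_last _)
    | last =>
      induction b using fin_chain_cases with
      | zero =>
        rw [tiltMod_last, tiltMod_zero]
        have := h.nontrivial_armMod 0
        exact iff_of_false (fun hg => not_nontrivial PUnit (hg.trans hfst).nontrivial)
          (by simp)
      | succ j hj =>
        rw [tiltMod_last, tiltMod_succ hj]
        exact iff_of_false (h.not_gen_punit_armTilt hj) (by simp [Fin.le_def]; omega)
      | last => exact iff_of_true (hlast _) le_rfl
  · change _ ↔ b = Fin.last (n + 2)
    have hc := Nat.lt_succ_iff.1 c.2
    rw [tiltMod_inr]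
    induction b using fin_chain_cases with
    | zero =>
      rw [tiltMod_zero]
      refine iff_of_false (fun hg => ?_) (by simp [Fin.ext_iff])
      exact h.not_gen_armTilt_armMod_swap hc 0 (hg.trans hfst)
    | succ j hj =>
      rw [tiltMod_succ hj]
      exact iff_of_false (h.not_gen_armTilt_swap hc hj) (by simp [Fin.ext_iff]; omega)
    | last => exact iff_of_true (hlast (.inr c)) rfl
  · change _ ↔ c = 0
    have hb := Nat.lt_succ_iff.1 b.2
    induction c using fin_chain_cases with
    | zero => exact iff_of_true (hzero _) rfl
    | succ i hi =>
      rw [tiltMod_succ hi, tiltMod_inr]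
      exact iff_of_false (h.swap.not_gen_armTilt_swap hi hb) (by simp [Fin.ext_iff])
    | last =>
      rw [tiltMod_last, tiltMod_inr]
      exact iff_of_false (h.swap.not_gen_punit_armTilt hb) (by simp [Fin.ext_iff])
  · rw [tiltMod_inr, tiltMod_inr,
      h.swap.gen_armTilt_iff (Nat.lt_succ_iff.1 c.2) (Nat.lt_succ_iff.1 b.2)]
    rfl

theorem exists_pe_tiltMod [IsNoetherianRing A] (h : TwoArmed K E F α β n n') {M : Mdl A}
    (hM : IsTauRigid M) : ∃ b, PE (tiltMod E F α β n n' b) M := by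
  let _ : Module K M := Module.compHom M (algebraMap K A)
  have : IsScalarTower K A M := ⟨fun c a x => by
    rw [Algebra.smul_def, mul_smul]; rfl⟩
  have := hM.1
  simp only [PE, facLE_iff]
  by_cases hF : coTop K F α β M = ⊤
  · by_cases hE : coTop K E α β M = ⊤
    · have := h.subsingleton_of_coTop hF hE
      refine ⟨.inl (Fin.last _), ?_, .of_subsingleton⟩
      rw [tiltMod_last]
      exact .of_subsingleton
    · rw [coTop_comm] at hE hF
      obtain ⟨j, hj, h1, h2⟩ := h.swap.exists_gen_armMod hM hE hF
      refine ⟨.inr ⟨j, Nat.lt_succ_iff.2 hj⟩, ?_⟩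
      rw [tiltMod_inr]
      exact ⟨h1.trans (gen_armMod_armTilt E β hj), (gen_armTilt_armMod E β hj).trans h2⟩
  · by_cases hE : coTop K E α β M = ⊤
    · obtain ⟨j, hj, h1, h2⟩ := h.exists_gen_armMod hM hF hE
      refine ⟨.inl ⟨j + 1, by omega⟩, ?_⟩
      rw [tiltMod_succ hj]
      exact ⟨h1.trans (gen_armMod_armTilt F α hj), (gen_armTilt_armMod F α hj).trans h2⟩
    · refine ⟨.inl 0, ?_⟩
      rw [tiltMod_zero]
      exact ⟨.of_prod (h.gen_of_coTop_ne_top hM hF (.inl hE))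
        (h.gen_of_coTop_ne_top hM hF (.inl hE)), h.gen_armMod_prod M⟩

theorem isTauRigid_tiltMod (h : TwoArmed K E F α β n n') (b) :
    IsTauRigid (tiltMod E F α β n n' b) := by
  have harm : ∀ {E F : A} {α β : ℕ → A} {n n' : ℕ}, TwoArmed K E F α β n n' → ∀ j ≤ n,
      ∀ X : Mdl A, MemFac (armTilt F α n j) X → Ext1Vanish (armTilt F α n j) X := by
    intro E F α β n n' h j hj X hX
    have hX' : Gen A (ArmMod F α j) X := (gen_armMod_armTilt F α hj).trans hX
    rcases hj.lt_or_eq with hj | rfl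
    · rw [armTilt_of_lt hj]
      exact (h.ext1Vanish_armMod (Nat.le_succ j) hX').dsum (h.ext1Vanish_armMod le_rfl hX')
    · rw [armTilt_self]
      exact h.ext1Vanish_armMod (Nat.le_succ j) hX'
  refine ⟨finite_tiltMod E F α β n n' b, fun X hX => ?_⟩
  rcases b with k | k
  · induction k using fin_chain_cases with
    | zero =>
      rw [tiltMod_zero]
      exact (h.ext1Vanish_armMod_zero X).dsum (h.swap.ext1Vanish_armMod_zero X)
    | succ j hj =>
      rw [tiltMod_succ hj] at hX ⊢
      exact harm h j hj X hX
    | last =>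
      rw [tiltMod_last]
      exact fun _ _ _ _ _ _ => ⟨0, LinearMap.ext fun _ => Subsingleton.elim _ _⟩
  · exact harm h.swap k (Nat.lt_succ_iff.1 k.2) X hX

end TwoArmed

theorem ple_antisymm (ℓ ℓ' : ℕ) (b c : Fin (ℓ + 2) ⊕ Fin ℓ') (hbc : Ple ℓ ℓ' b c)
    (hcb : Ple ℓ ℓ' c b) : b = c := by
  rcases b with b | b <;> rcases c with c | c
  · exact congrArg _ (le_antisymm hcb hbc)
  · exact absurd ((show b = Fin.last _ from hbc).symm.trans hcb) (by simp [Fin.ext_iff])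
  · exact absurd ((show c = Fin.last _ from hcb).symm.trans hbc) (by simp [Fin.ext_iff])
  · exact congrArg _ (le_antisymm hcb hbc)

/-- A complete set of representatives yields a poset isomorphism. -/
theorem nonempty_posetIsoTo {A : Type} [Ring A] {P : Mdl A → Prop} {B : Type} [Inhabited B]
    {le : B → B → Prop} (T : B → Mdl A) (hT : ∀ b, P (T b))
    (hle : ∀ b c, FacLE (T b) (T c) ↔ le b c) (hanti : ∀ b c, le b c → le c b → b = c)
    (hex : ∀ M, P M → ∃ b, PE (T b) M) : Nonempty (PosetIsoTo P B le) := by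
  classical
  let f : Mdl A → B := fun M => if h : ∃ b, PE (T b) M then h.choose else default
  have hf : ∀ M, P M → PE (T (f M)) M := fun M hM => by
    simp only [f, dif_pos (hex M hM)]
    exact (hex M hM).choose_spec
  have trans : ∀ {M N L : Mdl A}, FacLE M N → FacLE N L → FacLE M L :=
    fun h h' X hX => h' X (h X hX)
  exact ⟨{
    toFun := f
    invFun := T
    maps' := hT
    le_iff := fun M N hM hN => by
      rw [← hle]
      exact ⟨fun h => trans (hf M hM).1 (trans h (hf N hN).2),
        fun h => trans (hf M hM).2 (trans h (hf N hN).1)⟩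
    left_inv := hf
    right_inv := fun b =>
      hanti _ _ ((hle _ _).1 (hf _ (hT b)).1) ((hle _ _).1 (hf _ (hT b)).2) }⟩

section Opposite

variable {K Λ : Type} [Field K] [Ring Λ] [Algebra K Λ]
  {α β : ℕ → Λᵐᵒᵖ} {n n' : ℕ} (e : Fin 2 → Λ)

theorem ncard_supp_eq_two {M : Mdl Λᵐᵒᵖ} {u v : Fin 2} (huv : u ≠ v) {x y : M}
    (hx : op (e u) • x ≠ 0) (hy : op (e v) • y ≠ 0) : (Supp Λ e M).ncard = 2 := by
  have : Supp Λ e M = Set.univ := by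
    refine Set.eq_univ_of_forall fun i => ?_
    rcases (show i = u ∨ i = v by omega) with rfl | rfl
    · exact ⟨x, hx⟩
    · exact ⟨y, hy⟩
  rw [this, Set.ncard_univ, Nat.card_eq_fintype_card, Fintype.card_fin]

theorem isDecompOf_armTilt [IsNoetherianRing Λᵐᵒᵖ] {u v : Fin 2} (huv : u ≠ v)
    (h : TwoArmed K (op (e u)) (op (e v)) α β n n') {j : ℕ} (hj : j ≤ n) :
    HasNumSummands (armTilt (op (e v)) α n j) (Supp Λ e (armTilt (op (e v)) α n j)).ncard ∧
      IsBasicMod (armTilt (op (e v)) α n j) := by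
  have hE : ∀ j, op (e u) • ArmMod.gen (op (e v)) α j ≠ 0 := fun j => by
    rw [h.E_smul_gen]
    exact h.gen_ne_zero j
  rcases hj.lt_or_eq with hj | rfl
  · rw [armTilt_of_lt hj]
    have hF : op (e v) • armPath (op (e v)) α (j + 1) • ArmMod.gen (op (e v)) α j ≠ 0 := by
      rw [← mul_smul, h.F_mul_armPath]
      exact h.armPath_succ_smul_gen_ne hj
    refine ⟨?_, isBasicMod_dsum (h.isIndec_armMod j) (h.isIndec_armMod (j + 1)) ⟨fun c => ?_⟩⟩
    · rw [ncard_supp_eq_two e huv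
        (M := dsum (ModuleCat.of _ (ArmMod (op (e v)) α j))
          (ModuleCat.of _ (ArmMod (op (e v)) α (j + 1))))
        (x := (ArmMod.gen (op (e v)) α j, 0))
        (y := (armPath (op (e v)) α (j + 1) • ArmMod.gen (op (e v)) α j, 0))
        (fun h0 => hE j (congrArg Prod.fst h0)) (fun h0 => hF (congrArg Prod.fst h0))]
      exact ⟨_, isDecompOf_dsum (h.isIndec_armMod j) (h.isIndec_armMod (j + 1))⟩
    · have hg : Gen Λᵐᵒᵖ (ArmMod (op (e v)) α (j + 1)) (ArmMod (op (e v)) α j) :=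
        .of_surjective c.symm.toLinearMap c.symm.surjective
      rw [h.gen_armMod_iff (by omega)] at hg
      omega
  · rw [armTilt_self]
    refine ⟨?_, isBasicMod_single (h.isIndec_armMod j)⟩
    have : Supp Λ e (ModuleCat.of Λᵐᵒᵖ (ArmMod (op (e v)) α j)) = {u} := by
      ext i
      rcases (show i = u ∨ i = v by omega) with rfl | rfl
      · exact iff_of_true ⟨_, hE j⟩ rfl
      · refine iff_of_false ?_ (Ne.symm huv)
        rintro ⟨x, hx⟩
        exact hx (h.F_smul_armMod_eq_zero x)
    rw [this, Set.ncard_singleton]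
    exact ⟨_, isDecompOf_single (h.isIndec_armMod j)⟩

theorem isBSTT_tiltMod [IsNoetherianRing Λᵐᵒᵖ] (h : TwoArmed K (op (e 0)) (op (e 1)) α β n n') (b) :
    IsBSTT Λ e (tiltMod (op (e 0)) (op (e 1)) α β n n' b) := by
  suffices H : HasNumSummands (tiltMod (op (e 0)) (op (e 1)) α β n n' b)
      (Supp Λ e (tiltMod (op (e 0)) (op (e 1)) α β n n' b)).ncard ∧
      IsBasicMod (tiltMod (op (e 0)) (op (e 1)) α β n n' b) from
    ⟨⟨TwoArmed.finite_tiltMod _ _ α β n n' b, h.isTauRigid_tiltMod b, H.1⟩, H.2⟩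
  rcases b with k | k
  · induction k using fin_chain_cases with
    | zero =>
      rw [tiltMod_zero]
      have hM := h.isIndec_armMod 0
      have hN := h.swap.isIndec_armMod 0
      refine ⟨?_, isBasicMod_dsum hM hN ⟨fun c => ?_⟩⟩
      · rw [ncard_supp_eq_two e (show (0 : Fin 2) ≠ 1 by decide)
          (M := dsum (ModuleCat.of _ (ArmMod (op (e 1)) α 0))
            (ModuleCat.of _ (ArmMod (op (e 0)) β 0)))
          (x := (ArmMod.gen (op (e 1)) α 0, 0)) (y := (0, ArmMod.gen (op (e 0)) β 0))
          (fun h0 => h.gen_ne_zero 0 ((h.E_smul_gen 0).symm.trans (congrArg Prod.fst h0)))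
          (fun h0 => h.swap.gen_ne_zero 0
            ((h.swap.E_smul_gen 0).symm.trans (congrArg Prod.snd h0)))]
        exact ⟨_, isDecompOf_dsum hM hN⟩
      · exact h.not_gen_armMod_swap 0 0 (.of_surjective c.symm.toLinearMap c.symm.surjective)
    | succ j hj =>
      rw [tiltMod_succ hj]
      exact isDecompOf_armTilt e (by decide) h hj
    | last =>
      rw [tiltMod_last]
      have hdec : IsDecompOf (ModuleCat.of Λᵐᵒᵖ PUnit)
          (Fin.elim0 : Fin 0 → Submodule Λᵐᵒᵖ PUnit) :=
        ⟨fun i => i.elim0, Subsingleton.elim _ _, fun i => i.elim0⟩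
      have hsupp : Supp Λ e (ModuleCat.of Λᵐᵒᵖ PUnit) = ∅ :=
        Set.eq_empty_of_forall_notMem fun i ⟨m, hm⟩ => hm (Subsingleton.elim _ _)
      rw [hsupp, Set.ncard_empty]
      exact ⟨⟨_, hdec⟩, 0, _, hdec, fun i => i.elim0⟩
  · exact isDecompOf_armTilt e (by decide) h.swap (Nat.lt_succ_iff.1 k.2)

end Opposite

/-- The arrows `a 0, …, a (n - 1)` in the opposite algebra, extended by zero. -/
def opArrow {Λ : Type} [Ring Λ] (a : ℕ → Λ) (n k : ℕ) : Λᵐᵒᵖ :=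
  if k < n then op (a k) else 0

section OpArrow

variable {Λ : Type} [Ring Λ] {a b : ℕ → Λ} {n n' k : ℕ}

theorem opArrow_of_lt (h : k < n) : opArrow a n k = op (a k) :=
  if_pos h

theorem opArrow_of_le (h : n ≤ k) : opArrow a n k = 0 :=
  if_neg h.not_gt

theorem op_mul_opArrow_mul_op {x y : Λ} (h : k < n → x * a k * y = a k) :
    op y * opArrow a n k * op x = opArrow a n k := by
  rcases lt_or_ge k n with hk | hk
  · rw [opArrow_of_lt hk, ← op_mul, ← op_mul, ← mul_assoc, h hk]
  · rw [opArrow_of_le hk, mul_zero, zero_mul]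

theorem opArrow_mul_opArrow {l : ℕ} (h : k < n → l < n' → b l * a k = 0) :
    opArrow a n k * opArrow b n' l = 0 := by
  rcases lt_or_ge k n with hk | hk
  · rcases lt_or_ge l n' with hl | hl
    · rw [opArrow_of_lt hk, opArrow_of_lt hl, ← op_mul, h hk hl, op_zero]
    · rw [opArrow_of_le hl, mul_zero]
  · rw [opArrow_of_le hk, zero_mul]

theorem adjoin_opArrow_eq_top {K : Type} [Field K] [Algebra K Λ] {x y : Λ}
    (h : Algebra.adjoin K
      ({x, y} ∪ {z | ∃ k < n, z = a k} ∪ {z | ∃ k < n', z = b k}) = ⊤) :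
    Algebra.adjoin K
      ({op x, op y} ∪ Set.range (opArrow a n) ∪ Set.range (opArrow b n')) = ⊤ := by
  rw [← Subalgebra.op_unop (Algebra.adjoin K _), ← Subalgebra.op_top]
  refine congrArg _ (top_le_iff.1 (h ▸ Algebra.adjoin_le ?_))
  rintro z ((hz | ⟨k, hk, rfl⟩) | ⟨k, hk, rfl⟩)
  · refine Algebra.subset_adjoin (.inl (.inl ?_))
    rcases hz with rfl | rfl
    · exact .inl rfl
    · exact .inr rfl
  · exact Algebra.subset_adjoin (.inl (.inr ⟨k, opArrow_of_lt hk⟩))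
  · exact Algebra.subset_adjoin (.inr ⟨k, opArrow_of_lt hk⟩)

end OpArrow

end TauTilting

open TauTilting in
/-- For all `ℓ, ℓ' ≥ 1` there is a poset isomorphism
`sτtilt Λ^{(ℓ,ℓ')} ≅ P_{ℓ,ℓ'}`.  The algebra `Λ^{(ℓ,ℓ')} = KQ^{(ℓ,ℓ')}/I^{(ℓ,ℓ')}`
is characterized as a basic algebra on two vertices `0, 1` with arrows
`a 0 : 0 → 1`, loops `a 1, …, a (ℓ-2)` at `0`, `b 0 : 1 → 0`, loops
`b 1, …, b (ℓ'-2)` at `1`, subject to the monomial relations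
`aᵢaⱼ (i ≠ j+1)`, `bᵢbⱼ (i ≠ j+1)`, `aᵢbⱼ`, `bⱼaᵢ`; this is pinned down by the
generators, the relations, and the dimension count
`dim Λ = 2 + ℓ(ℓ-1)/2 + ℓ'(ℓ'-1)/2`. -/
theorem statement13
    (ℓ ℓ' : ℕ) (hℓ : 1 ≤ ℓ) (hℓ' : 1 ≤ ℓ')
    (K : Type) [Field K]
    (Λ : Type) [Ring Λ] [Algebra K Λ] [FiniteDimensional K Λ]
    (e : Fin 2 → Λ)
    (he : CompletePrimIdems Λ e) (hbasic : IsBasicAlg Λ e)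
    (a b : ℕ → Λ)
    -- placement of the arrows
    (ha0 : 2 ≤ ℓ → e 0 * a 0 * e 1 = a 0)
    (hak : ∀ k, 1 ≤ k → k < ℓ - 1 → e 0 * a k * e 0 = a k)
    (hb0 : 2 ≤ ℓ' → e 1 * b 0 * e 0 = b 0)
    (hbk : ∀ k, 1 ≤ k → k < ℓ' - 1 → e 1 * b k * e 1 = b k)
    (harad : ∀ k < ℓ - 1, a k ∈ radK K Λ)
    (hbrad : ∀ k < ℓ' - 1, b k ∈ radK K Λ)
    -- the relations of I^{(ℓ,ℓ')}
    (haa : ∀ k l, k < ℓ - 1 → l < ℓ - 1 → k ≠ l + 1 → a k * a l = 0)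
    (hbb : ∀ k l, k < ℓ' - 1 → l < ℓ' - 1 → k ≠ l + 1 → b k * b l = 0)
    (hab : ∀ k l, k < ℓ - 1 → l < ℓ' - 1 → a k * b l = 0 ∧ b l * a k = 0)
    -- the arrows form a basis of rad/rad²
    (hspan : radK K Λ ≤
      Submodule.span K ({x | ∃ k < ℓ - 1, x = a k} ∪ {x | ∃ k < ℓ' - 1, x = b k}) ⊔
        radK K Λ * radK K Λ)
    (hindep : ∀ c d : ℕ → K,
      ((∑ k ∈ Finset.range (ℓ - 1), c k • a k) +
        (∑ k ∈ Finset.range (ℓ' - 1), d k • b k)) ∈ radK K Λ * radK K Λ →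
      (∀ k < ℓ - 1, c k = 0) ∧ (∀ k < ℓ' - 1, d k = 0))
    -- Λ is generated by the idempotents and the arrows
    (hgen : Algebra.adjoin K
      ({e 0, e 1} ∪ {x | ∃ k < ℓ - 1, x = a k} ∪ {x | ∃ k < ℓ' - 1, x = b k}) = ⊤)
    -- the dimension of Λ^{(ℓ,ℓ')}
    (hdim : Module.finrank K Λ = 2 + ℓ * (ℓ - 1) / 2 + ℓ' * (ℓ' - 1) / 2) :
    Nonempty (PosetIsoTo (IsBSTT Λ e) (Fin (ℓ + 2) ⊕ Fin ℓ') (Ple ℓ ℓ')) := by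
  obtain ⟨n, rfl⟩ : ∃ n, ℓ = n + 1 := ⟨ℓ - 1, by omega⟩
  obtain ⟨n', rfl⟩ : ∃ n', ℓ' = n' + 1 := ⟨ℓ' - 1, by omega⟩
  simp only [Nat.add_sub_cancel] at hak hbk haa hbb hab hgen hdim
  obtain ⟨hprim, horth, hsum⟩ := he
  rw [Fin.sum_univ_two] at hsum
  have hrel : TwoArmedRel K (op (e 0)) (op (e 1)) (opArrow a n) (opArrow b n') n n' :=
    { E_mul_E := by rw [← op_mul, (hprim 0).1.eq]
      F_mul_F := by rw [← op_mul, (hprim 1).1.eq]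
      E_mul_F := by rw [← op_mul, horth (by decide), op_zero]
      F_mul_E := by rw [← op_mul, horth (by decide), op_zero]
      E_add_F := by rw [← op_add, hsum, op_one]
      E_ne := (op_ne_zero_iff _).2 (hprim 0).2.1
      F_ne := (op_ne_zero_iff _).2 (hprim 1).2.1
      α_zero := op_mul_opArrow_mul_op fun h => ha0 (by omega)
      α_succ := fun k => op_mul_opArrow_mul_op (hak _ (Nat.le_add_left 1 k))
      β_zero := op_mul_opArrow_mul_op fun h => hb0 (by omega)
      β_succ := fun k => op_mul_opArrow_mul_op (hbk _ (Nat.le_add_left 1 k))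
      α_eq_zero := fun _ => opArrow_of_le
      β_eq_zero := fun _ => opArrow_of_le
      α_mul_α := fun k l hkl => opArrow_mul_opArrow fun hk hl => haa l k hl hk hkl
      β_mul_β := fun k l hkl => opArrow_mul_opArrow fun hk hl => hbb l k hl hk hkl
      α_mul_β := fun k l => opArrow_mul_opArrow fun hk hl => (hab k l hk hl).2
      β_mul_α := fun k l => opArrow_mul_opArrow fun hk hl => (hab l k hl hk).1
      adjoin_eq_top := adjoin_opArrow_eq_top hgen }
  have h := hrel.twoArmed (MulOpposite.finrank.trans hdim)
  have : IsNoetherianRing Λᵐᵒᵖ := .of_finite K Λᵐᵒᵖ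
  have : Inhabited (Fin (n + 1 + 2) ⊕ Fin (n' + 1)) := ⟨.inl 0⟩
  exact nonempty_posetIsoTo _ (isBSTT_tiltMod e h) h.facLE_tiltMod_iff (ple_antisymm _ _)
    fun M hM => h.exists_pe_tiltMod hM.1.2.1
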